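/- arXiv:1005.2568 — 2 statements merged into one kernel-verified Lean document; each statement's English description precedes it below -/
import Mathlib

section
/- Fix positive integers k and n and let ζ ∈ ℂ be a primitive n-th root of unity. Let the cyclic group ℤ/nℤ act on the set X of all k-element multisets with elements from ℤ/nℤ by translation: d • M is the multiset obtained from M by adding d to every element (with multiplicity). Then for every natural number d and every polynomial P ∈ ℂ[q] satisfying P · [k]!_q · [n−1]!_q = [n+k−1]!_q (so P is the Gaussian binomial coefficient [n+k−1 choose k]_q), the number of k-element multisets M over ℤ/nℤ whose translate by d equals M is P(ζ^d). -/
open Polynomial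

/-- The `q`-integer `[m]_q = 1 + q + ⋯ + q^(m-1)` as a polynomial over `ℂ`. -/
noncomputable def qInt (m : ℕ) : Polynomial ℂ := ∑ i ∈ Finset.range m, X ^ i

/-- The `q`-factorial `[m]!_q = [m]_q [m-1]_q ⋯ [1]_q` as a polynomial over `ℂ`. -/
noncomputable def qFact : ℕ → Polynomial ℂ
  | 0 => 1
  | m + 1 => qFact m * qInt (m + 1)

section QIntegers

lemma qInt_ne_zero {m : ℕ} (hm : 0 < m) : qInt m ≠ 0 := by
  intro h
  have h1 := congrArg (Polynomial.eval 1) h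
  simp only [qInt, Polynomial.eval_finsetSum, Polynomial.eval_pow, Polynomial.eval_X, one_pow,
    Finset.sum_const, Finset.card_range, Polynomial.eval_zero, nsmul_eq_mul, mul_one,
    Nat.cast_eq_zero] at h1
  omega

lemma qFact_ne_zero (m : ℕ) : qFact m ≠ 0 := by
  induction m with
  | zero => exact one_ne_zero
  | succ m ih => exact mul_ne_zero ih (qInt_ne_zero m.succ_pos)

lemma qFact_add (m k : ℕ) :
    qFact (m + k) = qFact m * ∏ j ∈ Finset.range k, qInt (m + j + 1) := by
  induction k with
  | zero => simp
  | succ k ih => rw [Finset.prod_range_succ, ← mul_assoc, ← ih]; rfl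

lemma qFact_eq_prod (k : ℕ) : qFact k = ∏ j ∈ Finset.range k, qInt (j + 1) := by
  simpa [qFact] using qFact_add 0 k

lemma qInt_add (m k : ℕ) : qInt (m + k) = qInt m + X ^ m * qInt k := by
  simp only [qInt, Finset.sum_range_add, Finset.mul_sum, pow_add]

lemma qInt_mul (o s : ℕ) : qInt (o * s) = qInt o * (qInt s).comp (X ^ o) := by
  induction s with
  | zero => simp [qInt]
  | succ s ih =>
    rw [Nat.mul_succ, qInt_add, ih, qInt_add s 1]
    simp [qInt, pow_mul]
    ring

lemma eval_qInt_comp_pow {o : ℕ} {ω : ℂ} (hω : ω ^ o = 1) (s : ℕ) :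
    ((qInt s).comp (X ^ o)).eval ω = s := by
  simp [qInt, Polynomial.eval_finsetSum, hω]

lemma eval_qInt_ne_zero {o i : ℕ} {ω : ℂ} (hω : IsPrimitiveRoot ω o) (hi : 0 < i) (hio : i < o) :
    (qInt i).eval ω ≠ 0 := by
  intro h
  have h1 := geom_sum_mul ω i
  have h2 : ∑ j ∈ Finset.range i, ω ^ j = 0 := by
    simpa [qInt, Polynomial.eval_finsetSum] using h
  rw [h2, zero_mul] at h1
  exact hω.pow_ne_one_of_pos_of_lt hi.ne' hio (sub_eq_zero.mp h1.symm)

lemma eval_qInt_self {o : ℕ} {ω : ℂ} (hω : IsPrimitiveRoot ω o) (ho : 1 < o) :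
    (qInt o).eval ω = 0 := by
  simpa [qInt, Polynomial.eval_finsetSum] using hω.geom_sum_eq_zero ho

lemma eval_qInt_mul_add {o : ℕ} {ω : ℂ} (hω : IsPrimitiveRoot ω o) (ho : 1 < o) (s j : ℕ) :
    (qInt (o * s + j)).eval ω = (qInt j).eval ω := by
  simp [qInt_add, qInt_mul, eval_qInt_self hω ho, pow_mul, hω.pow_eq_one]

/-- The cofactor of `[p + 1]_q` in a product of `p + 1` consecutive `q`-integers whose only
multiple of `p + 1` is `(p + 1) * s` and whose other members lie just above `(p + 1) * b`. -/
noncomputable def qBlock (p s b : ℕ) : Polynomial ℂ :=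
  (qInt s).comp (X ^ (p + 1)) * ∏ j ∈ Finset.range p, qInt ((p + 1) * b + (j + 1))

lemma eval_qBlock {p : ℕ} {ω : ℂ} (hω : IsPrimitiveRoot ω (p + 1)) (s b : ℕ) :
    (qBlock p s b).eval ω = s * ∏ j ∈ Finset.range p, (qInt (j + 1)).eval ω := by
  rw [qBlock, Polynomial.eval_mul, eval_qInt_comp_pow hω.pow_eq_one, Polynomial.eval_prod]
  congr 1
  refine Finset.prod_congr rfl fun j hj => eval_qInt_mul_add hω ?_ b (j + 1)
  have := Finset.mem_range.mp hj
  omega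

lemma prod_qInt_ascending (p g a : ℕ) :
    ∏ j ∈ Finset.range ((p + 1) * a), qInt ((p + 1) * g + j) =
      qInt (p + 1) ^ a * ∏ c ∈ Finset.range a, qBlock p (g + c) (g + c) := by
  induction a with
  | zero => simp
  | succ a ih =>
    rw [Nat.mul_succ, Finset.prod_range_add, ih, Finset.prod_range_succ _ a,
      Finset.prod_range_succ' _ p, qBlock]
    simp only [← add_assoc, add_zero, ← mul_add]
    rw [qInt_mul]
    ring

lemma prod_qInt_succ (p a : ℕ) :
    ∏ j ∈ Finset.range ((p + 1) * a), qInt (j + 1) =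
      qInt (p + 1) ^ a * ∏ c ∈ Finset.range a, qBlock p (c + 1) c := by
  induction a with
  | zero => simp
  | succ a ih =>
    rw [Nat.mul_succ, Finset.prod_range_add, ih, Finset.prod_range_succ _ a,
      Finset.prod_range_succ _ p, qBlock, add_assoc _ p 1, ← Nat.mul_succ, qInt_mul]
    simp only [add_assoc]
    ring

/-- The value of a Gaussian binomial coefficient at a root of unity whose order divides `n`. -/
lemma eval_gaussian_binomial {p g a r : ℕ} {ω : ℂ} (hω : IsPrimitiveRoot ω (p + 1)) (hr : r ≤ p)
    {P : Polynomial ℂ}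
    (hP : P * ∏ j ∈ Finset.range ((p + 1) * a + r), qInt (j + 1) =
      ∏ j ∈ Finset.range ((p + 1) * a + r), qInt ((p + 1) * g + j)) :
    P.eval ω = if r = 0 then (g.multichoose a : ℂ) else 0 := by
  rw [Finset.prod_range_add, Finset.prod_range_add, prod_qInt_ascending, prod_qInt_succ] at hP
  have hcancel : P * ((∏ c ∈ Finset.range a, qBlock p (c + 1) c) *
        ∏ j ∈ Finset.range r, qInt ((p + 1) * a + j + 1)) =
      (∏ c ∈ Finset.range a, qBlock p (g + c) (g + c)) *
        ∏ j ∈ Finset.range r, qInt ((p + 1) * g + ((p + 1) * a + j)) := by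
    refine mul_left_cancel₀ (pow_ne_zero a (qInt_ne_zero p.succ_pos)) ?_
    linear_combination hP
  have heval := congrArg (Polynomial.eval ω) hcancel
  have hu : ∏ j ∈ Finset.range p, (qInt (j + 1)).eval ω ≠ 0 :=
    Finset.prod_ne_zero_iff.mpr fun j hj =>
      eval_qInt_ne_zero hω j.succ_pos (by have := Finset.mem_range.mp hj; omega)
  simp only [Polynomial.eval_mul, Polynomial.eval_prod, eval_qBlock hω, Finset.prod_mul_distrib,
    Finset.prod_const, Finset.card_range] at heval
  have hfact : ∏ c ∈ Finset.range a, ((c + 1 : ℕ) : ℂ) = (a.factorial : ℂ) := by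
    rw [← Nat.cast_prod, Finset.prod_range_add_one_eq_factorial]
  have hfact0 : (a.factorial : ℂ) ≠ 0 := Nat.cast_ne_zero.mpr a.factorial_ne_zero
  rw [hfact] at heval
  split_ifs with h
  · subst h
    have hasc : ∏ c ∈ Finset.range a, ((g + c : ℕ) : ℂ) = a.factorial * g.multichoose a := by
      rw [← Nat.cast_prod, ← Nat.ascFactorial_eq_prod_range, Nat.multichoose_eq,
        Nat.ascFactorial_eq_factorial_mul_choose', Nat.cast_mul]
    rw [hasc] at heval
    simp only [Finset.range_zero, Finset.prod_empty, mul_one] at heval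
    refine mul_right_cancel₀ (mul_ne_zero hfact0 (pow_ne_zero a hu)) ?_
    linear_combination heval
  · have hp : 1 < p + 1 := by omega
    have hzero : ∏ j ∈ Finset.range r, (qInt ((p + 1) * g + ((p + 1) * a + j))).eval ω = 0 := by
      refine Finset.prod_eq_zero (Finset.mem_range.mpr (Nat.pos_of_ne_zero h)) ?_
      rw [eval_qInt_mul_add hω hp, eval_qInt_mul_add hω hp]
      simp [qInt]
    have hne : ∏ j ∈ Finset.range r, (qInt ((p + 1) * a + j + 1)).eval ω ≠ 0 := by
      refine Finset.prod_ne_zero_iff.mpr fun j hj => ?_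
      rw [add_assoc, eval_qInt_mul_add hω hp]
      exact eval_qInt_ne_zero hω j.succ_pos (by have := Finset.mem_range.mp hj; omega)
    rw [hzero, mul_zero] at heval
    exact (mul_eq_zero.mp heval).resolve_right
      (mul_ne_zero (mul_ne_zero hfact0 (pow_ne_zero a hu)) hne)

end QIntegers

section FiberMultisets

variable {α β : Type*} [Fintype α] [DecidableEq β]

/-- The multiset on `α` whose multiplicity function is the pullback along `f` of that of `N`. -/
def Multiset.pullback (f : α → β) (N : Multiset β) : Multiset α :=
  N.bind fun b => (Finset.univ.filter fun x => f x = b).val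

lemma Multiset.count_pullback [DecidableEq α] (f : α → β) (N : Multiset β) (x : α) :
    (N.pullback f).count x = N.count (f x) := by
  induction N using Multiset.induction_on with
  | empty => simp [Multiset.pullback]
  | cons b N ih =>
    rw [Multiset.pullback] at ih ⊢
    rw [Multiset.cons_bind, Multiset.count_add, ih, Multiset.count_cons,
      Multiset.count_eq_of_nodup (Finset.nodup _), add_comm]
    simp

lemma Multiset.card_pullback {f : α → β} {o : ℕ}
    (hf : ∀ b, (Finset.univ.filter fun x => f x = b).card = o) (N : Multiset β) :
    Multiset.card (N.pullback f) = o * Multiset.card N := by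
  simp only [Multiset.pullback, Multiset.card_bind, Function.comp_def, Finset.card_val, hf,
    Multiset.map_const', Multiset.sum_replicate, smul_eq_mul, mul_comm]

lemma Multiset.pullback_injective {f : α → β} (hf : Function.Surjective f) :
    Function.Injective (Multiset.pullback f) := by
  classical
  intro N N' h
  ext b
  obtain ⟨x, rfl⟩ := hf b
  rw [← Multiset.count_pullback, h, Multiset.count_pullback]

lemma Multiset.exists_pullback_eq [DecidableEq α] [Fintype β] {f : α → β}
    (hf : Function.Surjective f) {M : Multiset α} (hM : ∀ x y, f x = f y → M.count x = M.count y) :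
    ∃ N : Multiset β, N.pullback f = M := by
  refine ⟨∑ b, Multiset.replicate (M.count (Function.surjInv hf b)) b, ?_⟩
  ext x
  rw [Multiset.count_pullback, Multiset.count_sum']
  simp only [Multiset.count_replicate, Finset.sum_ite_eq', Finset.mem_univ, if_true]
  exact hM _ _ (Function.surjInv_eq hf _)

/-- The number of multisets of given size whose multiplicities are constant on the fibers of `f`,
when all fibers have the same size. -/
lemma card_multiset_count_const_on_fibers [DecidableEq α] [Fintype β] {f : α → β}
    (hf : Function.Surjective f) {p a r : ℕ} (hr : r ≤ p)
    (hcard : ∀ b, (Finset.univ.filter fun x => f x = b).card = p + 1) :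
    Nat.card {M : Multiset α // Multiset.card M = (p + 1) * a + r ∧
      ∀ x y, f x = f y → M.count x = M.count y} =
        if r = 0 then (Fintype.card β).multichoose a else 0 := by
  split_ifs with h
  · subst h
    rw [← Sym.card_sym_eq_multichoose, ← Nat.card_eq_fintype_card]
    symm
    refine Nat.card_congr (Equiv.ofBijective (fun N : Sym β a =>
      ⟨(N : Multiset β).pullback f, ?_, fun x y hxy => ?_⟩) ⟨fun N N' h => ?_, ?_⟩)
    · rw [Multiset.card_pullback hcard, Sym.card_coe, add_zero]
    · rw [Multiset.count_pullback, Multiset.count_pullback, hxy]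
    · exact Sym.coe_injective (Multiset.pullback_injective hf (congrArg Subtype.val h))
    · rintro ⟨M, hMc, hM⟩
      obtain ⟨N, rfl⟩ := Multiset.exists_pullback_eq hf hM
      rw [Multiset.card_pullback hcard, add_zero] at hMc
      exact ⟨⟨N, Nat.eq_of_mul_eq_mul_left p.succ_pos hMc⟩, rfl⟩
  · rw [Nat.card_eq_zero]
    refine Or.inl ⟨?_⟩
    rintro ⟨M, hMc, hM⟩
    obtain ⟨N, rfl⟩ := Multiset.exists_pullback_eq hf hM
    rw [Multiset.card_pullback hcard] at hMc
    have hmod := congrArg (· % (p + 1)) hMc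
    simp only [Nat.mul_mod_right, Nat.mul_add_mod] at hmod
    rw [Nat.mod_eq_of_lt (Nat.lt_succ_of_le hr)] at hmod
    exact h hmod.symm

end FiberMultisets

section Translation

variable {G : Type*} [AddCommGroup G]

lemma map_add_right_eq_self_iff [DecidableEq G] (M : Multiset G) (d : G) :
    M.map (fun s => s + d) = M ↔
      ∀ x y : G, (x : G ⧸ AddSubgroup.zmultiples d) = (y : G ⧸ AddSubgroup.zmultiples d) →
        M.count x = M.count y := by
  have hcount : ∀ x, (M.map (fun s => s + d)).count (x + d) = M.count x := fun x =>
    Multiset.count_map_eq_count' _ M (add_left_injective d) x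
  constructor
  · intro h
    rw [h] at hcount
    have hz : ∀ (m : ℤ) x, M.count (x + m • d) = M.count x := by
      intro m
      induction m with
      | zero => simp
      | succ i ih => intro x; rw [add_zsmul, one_zsmul, ← add_assoc, hcount, ih]
      | pred i ih =>
        intro x
        rw [← hcount, ← ih x, sub_zsmul, one_zsmul]
        congr 1
        abel
    intro x y hxy
    obtain ⟨m, hm⟩ := AddSubgroup.mem_zmultiples_iff.mp (QuotientAddGroup.eq.mp hxy)
    rw [← hz m x, hm, add_neg_cancel_left]
  · intro h
    ext x
    rw [← sub_add_cancel x d, hcount]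
    refine h _ _ (QuotientAddGroup.eq.mpr ?_)
    simp

lemma card_fiber_quotient_zmultiples [Fintype G] (d : G)
    [DecidableEq (G ⧸ AddSubgroup.zmultiples d)] (b : G ⧸ AddSubgroup.zmultiples d) :
    (Finset.univ.filter fun x : G => (x : G ⧸ AddSubgroup.zmultiples d) = b).card =
      addOrderOf d := by
  obtain ⟨y, rfl⟩ := QuotientAddGroup.mk_surjective b
  rw [← Nat.card_zmultiples, ← Fintype.card_subtype, ← Nat.card_eq_fintype_card]
  refine Nat.card_congr ⟨fun x => ⟨-y + x, QuotientAddGroup.eq.mp x.2.symm⟩,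
    fun h => ⟨y + h, ?_⟩, fun x => ?_, fun h => ?_⟩
  · exact (QuotientAddGroup.eq.mpr (by simp)).symm
  · simp
  · simp

end Translation

lemma IsPrimitiveRoot.pow_addOrderOf {n : ℕ} {ζ : ℂ} (hζ : IsPrimitiveRoot ζ n) (d : ℕ) :
    IsPrimitiveRoot (ζ ^ d) (addOrderOf (d : ZMod n)) := by
  have key : ∀ m, (ζ ^ d) ^ m = 1 ↔ addOrderOf (d : ZMod n) ∣ m := by
    intro m
    rw [← pow_mul, hζ.pow_eq_one_iff_dvd, addOrderOf_dvd_iff_nsmul_eq_zero, nsmul_eq_mul,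
      ← Nat.cast_mul, ZMod.natCast_eq_zero_iff, mul_comm]
  exact ⟨(key _).mpr dvd_rfl, fun m => (key m).mp⟩

/-- **Cyclic sieving for `k`-element multisets (Reiner–Stanton–White).**
Fix positive integers `k` and `n` and a primitive `n`-th root of unity `ζ`.  The cyclic
group `ℤ/nℤ` acts on `k`-element multisets over `ℤ/nℤ` by translation.  For every `d` and
every polynomial `P` with `P · [k]!_q · [n-1]!_q = [n+k-1]!_q` (i.e. the Gaussian binomial
`[n+k-1 choose k]_q`), the number of `k`-multisets fixed by translation by `d` is `P(ζ^d)`. -/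
theorem csp_multisets (n k : ℕ) (hn : 0 < n) (hk : 0 < k)
    (ζ : ℂ) (hζ : IsPrimitiveRoot ζ n) (d : ℕ)
    (P : Polynomial ℂ) (hP : P * qFact k * qFact (n - 1) = qFact (n + k - 1)) :
    (Nat.card {M : Multiset (ZMod n) // Multiset.card M = k ∧
        M.map (fun s => s + (d : ZMod n)) = M} : ℂ) = P.eval (ζ ^ d) := by
  classical
  have : NeZero n := ⟨hn.ne'⟩
  have hω := hζ.pow_addOrderOf d
  have hfib := card_fiber_quotient_zmultiples (d : ZMod n)
  have hQ : n = addOrderOf (d : ZMod n) *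
      Fintype.card (ZMod n ⧸ AddSubgroup.zmultiples (d : ZMod n)) := by
    have h := AddSubgroup.card_eq_card_quotient_mul_card_addSubgroup
      (AddSubgroup.zmultiples (d : ZMod n))
    rw [Nat.card_zmultiples, Nat.card_zmod, Nat.card_eq_fintype_card] at h
    rw [mul_comm]
    exact h
  have hprod : P * ∏ j ∈ Finset.range k, qInt (j + 1) = ∏ j ∈ Finset.range k, qInt (n + j) := by
    refine mul_right_cancel₀ (qFact_ne_zero (n - 1)) ?_
    rw [← qFact_eq_prod, hP, show n + k - 1 = n - 1 + k by omega, qFact_add, mul_comm]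
    congr 1
    refine Finset.prod_congr rfl fun j _ => ?_
    congr 1
    omega
  obtain ⟨p, hp⟩ : ∃ p, addOrderOf (d : ZMod n) = p + 1 :=
    Nat.exists_eq_add_one.mpr (addOrderOf_pos _)
  simp only [map_add_right_eq_self_iff]
  rw [hp] at hω
  simp only [hp] at hfib
  rw [hp] at hQ
  have hr : k % (p + 1) ≤ p := Nat.lt_succ_iff.mp (Nat.mod_lt _ p.succ_pos)
  have hcount := card_multiset_count_const_on_fibers (a := k / (p + 1))
    (QuotientAddGroup.mk_surjective (s := AddSubgroup.zmultiples (d : ZMod n))) hr hfib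
  have heval := eval_gaussian_binomial (g := Fintype.card
    (ZMod n ⧸ AddSubgroup.zmultiples (d : ZMod n))) (a := k / (p + 1)) hω hr (P := P)
    (by rw [Nat.div_add_mod, ← hQ]; exact hprod)
  rw [Nat.div_add_mod] at hcount
  rw [hcount, heval]
  split_ifs <;> simp
end

section
/- Fix a positive integer n and let ζ ∈ ℂ be a primitive 2n-th root of unity. A perfect matching M of ℤ/2nℤ (a partition of ℤ/2nℤ into n two-element blocks) is noncrossing if there do not exist representatives 0 ≤ a < b < c < d < 2n with {a,c} ∈ M and {b,d} ∈ M. The cyclic group ℤ/2nℤ acts on perfect matchings by rotation: d • M = {{x + d, y + d} : {x,y} ∈ M}. Then: (i) the rotation of a noncrossing perfect matching is again noncrossing; and (ii) for every natural number d and every polynomial P ∈ ℂ[q] satisfying P · [n+1]_q · [n]!_q · [n]!_q = [2n]!_q (so P is the q-Catalan number C_n(q) = (1/[n+1]_q)·[2n choose n]_q), the number of noncrossing perfect matchings M of ℤ/2nℤ with d • M = M equals P(ζ^d). -/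
open Polynomial

/-- A perfect matching of `ℤ/2nℤ`: a partition of `ℤ/2nℤ` into `n` two-element blocks. -/
def IsPerfectMatching (n : ℕ) (M : Finset (Finset (ZMod (2 * n)))) : Prop :=
  M.card = n ∧ (∀ p ∈ M, p.card = 2) ∧ ∀ x : ZMod (2 * n), ∃! p, p ∈ M ∧ x ∈ p

/-- A perfect matching of `ℤ/2nℤ` is noncrossing if there are no representatives
`0 ≤ a < b < c < d < 2n` with `{a,c}` and `{b,d}` both blocks of the matching. -/
def IsNoncrossing (n : ℕ) (M : Finset (Finset (ZMod (2 * n)))) : Prop :=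
  ¬ ∃ a b c d : ℕ, a < b ∧ b < c ∧ c < d ∧ d < 2 * n ∧
    ({(a : ZMod (2 * n)), (c : ZMod (2 * n))} : Finset (ZMod (2 * n))) ∈ M ∧
    ({(b : ZMod (2 * n)), (d : ZMod (2 * n))} : Finset (ZMod (2 * n))) ∈ M

/-- Rotation of a matching of `ℤ/2nℤ` by `d`: add `d` to every element of every block. -/
def rotateMatching (n d : ℕ) (M : Finset (Finset (ZMod (2 * n)))) :
    Finset (Finset (ZMod (2 * n))) :=
  M.image (fun p => p.image (fun x => x + (d : ZMod (2 * n))))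

/-- An arc diagram on `{0, …, g - 1}`, encoded by its partner function: an involution of `ℕ` fixing
every `x ≥ g`, such that arcs do not cross and no fixed point lies below an arc. -/
structure IsArcDiagram (g : ℕ) (a : ℕ → ℕ) : Prop where
  invol : ∀ x, a (a x) = x
  fix : ∀ x, g ≤ x → a x = x
  nest : ∀ x y, x < y → y < a x → a y ≠ y ∧ a y < a x

namespace IsArcDiagram

/-- The unmatched points of an arc diagram. -/
def free (g : ℕ) (a : ℕ → ℕ) : Finset ℕ := (Finset.range g).filter fun x => a x = x

theorem mem_free {g x : ℕ} {a : ℕ → ℕ} : x ∈ free g a ↔ x < g ∧ a x = x := by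
  simp [free]

theorem lt {g : ℕ} {a : ℕ → ℕ} (h : IsArcDiagram g a) {x : ℕ} (hx : x < g) : a x < g := by
  by_contra! hc
  have h1 := h.fix _ hc
  rw [h.invol] at h1
  omega

/-- Match the new point `g` with the last unmatched point. -/
def close (g : ℕ) (a : ℕ → ℕ) (x : ℕ) : ℕ :=
  if x = g then (free g a).sup id else if x = (free g a).sup id then g else a x

theorem sup_mem_free {g : ℕ} {a : ℕ → ℕ} (h : (free g a).Nonempty) :
    (free g a).sup id ∈ free g a := by
  obtain ⟨x, hx, he⟩ := Finset.exists_mem_eq_sup _ h id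
  rw [he]
  exact hx

theorem le_sup_free {g x : ℕ} {a : ℕ → ℕ} (h : x ∈ free g a) : x ≤ (free g a).sup id :=
  Finset.le_sup (f := id) h

theorem succ {g : ℕ} {a : ℕ → ℕ} (h : IsArcDiagram g a) : IsArcDiagram (g + 1) a :=
  ⟨h.invol, fun x hx => h.fix x (by omega), h.nest⟩

theorem free_succ {g : ℕ} {a : ℕ → ℕ} (h : IsArcDiagram g a) :
    free (g + 1) a = insert g (free g a) := by
  ext x
  have := h.fix g le_rfl
  simp only [mem_free, Finset.mem_insert]
  constructor
  · rintro ⟨h1, h2⟩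
    by_cases hx : x = g
    · exact Or.inl hx
    · exact Or.inr ⟨by omega, h2⟩
  · rintro (rfl | ⟨h1, h2⟩)
    · exact ⟨by omega, this⟩
    · exact ⟨by omega, h2⟩

theorem card_free_succ {g : ℕ} {a : ℕ → ℕ} (h : IsArcDiagram g a) :
    (free (g + 1) a).card = (free g a).card + 1 := by
  rw [h.free_succ, Finset.card_insert_of_notMem]
  simp [mem_free]

theorem close_isArcDiagram {g : ℕ} {a : ℕ → ℕ} (h : IsArcDiagram g a)
    (hne : (free g a).Nonempty) : IsArcDiagram (g + 1) (close g a) := by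
  have hj := sup_mem_free hne
  have hle : ∀ x, x < g → a x = x → x ≤ (free g a).sup id :=
    fun x h1 h2 => le_sup_free (mem_free.2 ⟨h1, h2⟩)
  rw [mem_free] at hj
  unfold close
  generalize (free g a).sup id = j at *
  obtain ⟨hj1, hj2⟩ := hj
  have hi := h.invol
  have hg := h.fix g le_rfl
  refine ⟨fun x => ?_, fun x hx => ?_, fun x y hxy hy => ?_⟩
  · have h1 := hi x
    by_cases hx : x = g
    · simp [hx]
    · by_cases hx' : x = j
      · simp [hx']
      · have h2 : a x ≠ g := fun h => by rw [h, hg] at h1; omega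
        have h3 : a x ≠ j := fun h => by rw [h, hj2] at h1; omega
        simp [hx, hx', h2, h3, h1]
  · have := h.fix x (by omega)
    rw [if_neg (by omega), if_neg (by omega), this]
  · by_cases hx : x = g
    · simp [hx] at hy
      omega
    · by_cases hx' : x = j
      · subst hx'
        simp [hx] at hy ⊢
        have h1 := hle y hy
        have h2 := h.lt hy
        rw [if_neg (by omega), if_neg (by omega)]
        exact ⟨fun h => by have := h1 h; omega, h2⟩
      · simp only [hx, hx', if_false] at hy ⊢
        have h1 := h.nest x y hxy hy
        have h2 : x < g := by
          by_contra! hc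
          have := h.fix x hc
          omega
        have h3 := h.lt h2
        have h4 : y ≠ j := fun h => by rw [h, hj2] at h1; omega
        rw [if_neg (by omega), if_neg (by omega)]
        exact h1

theorem free_close {g : ℕ} {a : ℕ → ℕ} (hne : (free g a).Nonempty) :
    free (g + 1) (close g a) = (free g a).erase ((free g a).sup id) := by
  have hj := sup_mem_free hne
  rw [mem_free] at hj
  ext x
  rw [Finset.mem_erase, mem_free, mem_free]
  unfold close
  generalize (free g a).sup id = j at *
  constructor
  · rintro ⟨h1, h2⟩
    split_ifs at h2 <;> omega
  · rintro ⟨h1, h2, h3⟩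
    rw [if_neg (by omega), if_neg (by omega)]
    exact ⟨by omega, h3⟩

theorem card_free_close {g : ℕ} {a : ℕ → ℕ} (hne : (free g a).Nonempty) :
    (free (g + 1) (close g a)).card + 1 = (free g a).card := by
  rw [free_close hne, Finset.card_erase_add_one (sup_mem_free hne)]

theorem close_injective {g : ℕ} {a b : ℕ → ℕ} (ha : IsArcDiagram g a) (hb : IsArcDiagram g b)
    (hna : (free g a).Nonempty) (hnb : (free g b).Nonempty) (h : close g a = close g b) :
    a = b := by
  have h1 := sup_mem_free hna
  have h2 := sup_mem_free hnb
  have h3 := congrFun h g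
  simp only [close, if_true] at h3
  rw [← h3] at h2
  rw [mem_free] at h1 h2
  funext x
  have h4 := congrFun h x
  simp only [close, ← h3] at h4
  by_cases hx : x = g
  · rw [hx, ha.fix g le_rfl, hb.fix g le_rfl]
  · by_cases hx' : x = (free g a).sup id
    · rw [hx', h1.2, h2.2]
    · simpa [hx, hx'] using h4

theorem of_succ {g : ℕ} {a : ℕ → ℕ} (h : IsArcDiagram (g + 1) a) (hg : a g = g) :
    IsArcDiagram g a := by
  refine ⟨h.invol, fun x hx => ?_, h.nest⟩
  rcases hx.eq_or_lt with rfl | hx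
  · exact hg
  · exact h.fix x hx

theorem exists_close {g : ℕ} {a : ℕ → ℕ} (h : IsArcDiagram (g + 1) a) (hg : a g ≠ g) :
    ∃ b, IsArcDiagram g b ∧ (free g b).Nonempty ∧ close g b = a := by
  have hi := h.invol
  have hlt := h.lt (Nat.lt_succ_self g)
  obtain ⟨j, hj⟩ : ∃ j, a g = j := ⟨_, rfl⟩
  have hj' : a j = g := by rw [← hj, hi]
  have hne : ∀ x, x ≠ g → x ≠ j → a x ≠ g ∧ a x ≠ j := by
    intro x h1 h2
    have := hi x
    constructor <;> intro h3 <;> rw [h3] at this <;> omega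
  let b : ℕ → ℕ := fun x => if x = g ∨ x = j then x else a x
  have hb : IsArcDiagram g b := by
    refine ⟨fun x => ?_, fun x hx => ?_, fun x y hxy hy => ?_⟩
    · by_cases hx : x = g ∨ x = j
      · simp [b, hx]
      · have := hne x (by omega) (by omega)
        simp only [b, hx, if_false]
        rw [if_neg (by omega), hi]
    · by_cases hx' : x = g
      · simp [b, hx']
      · simp only [b]
        rw [h.fix x (by omega)]
        simp
    · by_cases hx : x = g ∨ x = j
      · simp [b, hx] at hy
        omega
      · simp only [b, hx, if_false] at hy ⊢
        have h1 := h.nest x y hxy hy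
        have h2 := hne x (by omega) (by omega)
        have h3 : x < g + 1 := by
          by_contra! hc
          have := h.fix x hc
          omega
        have h4 := h.lt h3
        have h5 : y ≠ j := fun h => by rw [h, hj'] at h1; omega
        rw [if_neg (by omega)]
        exact h1
  have hjf : j ∈ free g b := by
    rw [mem_free]
    simp [b]
    omega
  have hsup : (free g b).sup id = j := by
    refine le_antisymm (Finset.sup_le fun x hx => ?_) (le_sup_free hjf)
    by_contra! hc
    simp only [id] at hc
    rw [mem_free] at hx
    simp only [b] at hx
    rw [if_neg (by omega)] at hx
    exact (h.nest j x hc (by omega)).1 hx.2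
  refine ⟨b, hb, ⟨j, hjf⟩, ?_⟩
  funext x
  simp only [close, hsup, b]
  split_ifs with h1 h2 h3
  · rw [h1, hj]
  · rw [h2, hj']
  · omega
  · rfl

theorem finite (g : ℕ) : {a | IsArcDiagram g a}.Finite := by
  induction g with
  | zero =>
    refine (Set.finite_singleton id).subset fun a h => ?_
    funext x
    exact h.fix x (Nat.zero_le x)
  | succ g ih =>
    refine (ih.union (ih.image (close g))).subset fun a h => ?_
    by_cases hg : a g = g
    · exact Or.inl (of_succ h hg)
    · obtain ⟨b, h1, -, h2⟩ := exists_close h hg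
      exact Or.inr ⟨b, h1, h2⟩

/-- The arc diagrams on `g` points with `m` unmatched points. -/
def withFree (g m : ℕ) : Set (ℕ → ℕ) := {a | IsArcDiagram g a ∧ (free g a).card = m}

theorem finite_withFree (g m : ℕ) : (withFree g m).Finite :=
  (finite g).subset fun _ h => h.1

theorem withFree_injOn_close (g m : ℕ) : Set.InjOn (close g) (withFree g (m + 1)) := by
  intro a ha b hb h
  refine close_injective ha.1 hb.1 ?_ ?_ h <;> rw [← Finset.card_pos]
  · rw [ha.2]; omega
  · rw [hb.2]; omega

theorem withFree_succ_zero (g : ℕ) : withFree (g + 1) 0 = close g '' withFree g 1 := by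
  ext a
  constructor
  · rintro ⟨h1, h2⟩
    by_cases hg : a g = g
    · have := (of_succ h1 hg).card_free_succ
      omega
    · obtain ⟨b, hb1, hb2, rfl⟩ := exists_close h1 hg
      have := card_free_close hb2
      exact ⟨b, ⟨hb1, by omega⟩, rfl⟩
  · rintro ⟨b, ⟨hb1, hb2⟩, rfl⟩
    have hne : (free g b).Nonempty := by rw [← Finset.card_pos]; omega
    have := card_free_close hne
    exact ⟨close_isArcDiagram hb1 hne, by omega⟩

theorem withFree_succ_succ (g m : ℕ) :
    withFree (g + 1) (m + 1) = withFree g m ∪ close g '' withFree g (m + 2) := by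
  ext a
  constructor
  · rintro ⟨h1, h2⟩
    by_cases hg : a g = g
    · have := (of_succ h1 hg).card_free_succ
      exact Or.inl ⟨of_succ h1 hg, by omega⟩
    · obtain ⟨b, hb1, hb2, rfl⟩ := exists_close h1 hg
      have := card_free_close hb2
      exact Or.inr ⟨b, ⟨hb1, by omega⟩, rfl⟩
  · rintro (⟨h1, h2⟩ | ⟨b, ⟨hb1, hb2⟩, rfl⟩)
    · exact ⟨h1.succ, by rw [h1.card_free_succ, h2]⟩
    · have hne : (free g b).Nonempty := by rw [← Finset.card_pos]; omega
      have := card_free_close hne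
      exact ⟨close_isArcDiagram hb1 hne, by omega⟩

theorem ncard_withFree_succ_zero (g : ℕ) :
    (withFree (g + 1) 0).ncard = (withFree g 1).ncard := by
  rw [withFree_succ_zero, (withFree_injOn_close g 0).ncard_image]

theorem ncard_withFree_succ_succ (g m : ℕ) :
    (withFree (g + 1) (m + 1)).ncard = (withFree g m).ncard + (withFree g (m + 2)).ncard := by
  rw [withFree_succ_succ, Set.ncard_union_eq ?_ (finite_withFree g m)
    ((finite_withFree g _).image _), (withFree_injOn_close g (m + 1)).ncard_image]
  rw [Set.disjoint_left]
  rintro _ ⟨h1, -⟩ ⟨b, ⟨hb1, hb2⟩, rfl⟩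
  have hne : (free g b).Nonempty := by rw [← Finset.card_pos]; omega
  have h2 := h1.fix g le_rfl
  have h3 := mem_free.1 (sup_mem_free hne)
  simp only [close, if_true] at h2
  omega

theorem card_free_le (g : ℕ) (a : ℕ → ℕ) : (free g a).card ≤ g := by
  simpa [free] using Finset.card_filter_le (Finset.range g) fun x => a x = x

theorem withFree_zero_zero : withFree 0 0 = {id} := by
  ext a
  constructor
  · rintro ⟨h, -⟩
    funext x
    exact h.fix x (Nat.zero_le x)
  · rintro rfl
    exact ⟨⟨fun _ => rfl, fun _ _ => rfl, fun x y h1 h2 => by simp at h2; omega⟩, by simp [free]⟩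

theorem withFree_eq_empty {g m : ℕ} (h : g < m) : withFree g m = ∅ := by
  ext a
  simp only [Set.mem_empty_iff_false, iff_false]
  rintro ⟨-, h2⟩
  have := card_free_le g a
  omega

theorem even_add_card_free {g : ℕ} {a : ℕ → ℕ} (h : IsArcDiagram g a) :
    Even (g + (free g a).card) := by
  induction g generalizing a with
  | zero => simp [free]
  | succ g ih =>
    by_cases hg : a g = g
    · have h1 := ih (of_succ h hg)
      rw [(of_succ h hg).card_free_succ]
      rw [Nat.even_iff] at *
      omega
    · obtain ⟨b, hb1, hb2, rfl⟩ := exists_close h hg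
      have h1 := ih hb1
      have := card_free_close hb2
      rw [Nat.even_iff] at *
      omega

/-- Ballot numbers: arc diagrams with `j + 1` arcs and `m` unmatched points. -/
theorem ncard_withFree (g : ℕ) :
    (withFree g g).ncard = 1 ∧ ∀ j m, g = m + 2 * (j + 1) →
      (withFree g m).ncard + g.choose j = g.choose (j + 1) := by
  induction g with
  | zero => exact ⟨by rw [withFree_zero_zero, Set.ncard_singleton], fun j m h => by omega⟩
  | succ g ih =>
    obtain ⟨ih1, ih2⟩ := ih
    refine ⟨?_, fun j m h => ?_⟩
    · rw [ncard_withFree_succ_succ, ih1, withFree_eq_empty (by omega), Set.ncard_empty]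
    · cases m with
      | zero =>
        rw [ncard_withFree_succ_zero]
        have hs : g.choose (j + 1) = g.choose j := by
          rw [← Nat.choose_symm_of_eq_add (show g = j + (j + 1) by omega)]
        cases j with
        | zero =>
          obtain rfl : g = 1 := by omega
          rw [ih1]; rfl
        | succ j =>
          have := ih2 j 1 (by omega)
          rw [Nat.choose_succ_succ', Nat.choose_succ_succ' g (j + 1)]
          omega
      | succ m =>
        rw [ncard_withFree_succ_succ]
        have h1 := ih2 j m (by omega)
        cases j with
        | zero =>
          obtain rfl : g = m + 2 := by omega
          rw [ih1]
          simp at h1 ⊢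
          omega
        | succ j =>
          have h2 := ih2 j (m + 2) (by omega)
          rw [Nat.choose_succ_succ', Nat.choose_succ_succ' g (j + 1)]
          omega

theorem ncard_withFree_two_mul (n : ℕ) :
    (withFree (2 * n) 0).ncard * ((n + 1).factorial * n.factorial) = (2 * n).factorial := by
  cases n with
  | zero => simp [(ncard_withFree 0).1]
  | succ n =>
    have h := (ncard_withFree (2 * (n + 1))).2 n 0 (by omega)
    have h1 := Nat.choose_mul_factorial_mul_factorial (show n ≤ 2 * (n + 1) by omega)
    have h2 := Nat.choose_mul_factorial_mul_factorial (show n + 1 ≤ 2 * (n + 1) by omega)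
    rw [show 2 * (n + 1) - n = n + 2 by omega] at h1
    rw [show 2 * (n + 1) - (n + 1) = n + 1 by omega] at h2
    rw [Nat.factorial_succ (n + 1), Nat.factorial_succ n] at *
    rw [← h] at h2
    zify at *
    linear_combination (n + 2 : ℤ) * h2 - (n + 1 : ℤ) * h1

theorem ncard_le_card_free (g j : ℕ) (h : 2 * j ≤ g) :
    {a | IsArcDiagram g a ∧ g - 2 * j ≤ (free g a).card}.ncard = g.choose j := by
  induction j with
  | zero =>
    rw [Nat.choose_zero_right, ← (ncard_withFree g).1]
    congr 1
    ext a
    have := card_free_le g a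
    simp only [withFree, Set.mem_ofPred_eq]
    exact and_congr_right fun _ => by omega
  | succ j ih =>
    rw [← (ncard_withFree g).2 j (g - 2 * (j + 1)) (by omega), ← ih (by omega),
      ← Set.ncard_union_eq ?_ (finite_withFree g _) ((finite g).subset fun _ h => h.1)]
    · congr 1
      ext a
      simp only [withFree, Set.mem_ofPred_eq, Set.mem_union]
      constructor
      · rintro ⟨h1, h2⟩
        have := h1.even_add_card_free
        rw [Nat.even_iff] at this
        by_cases hc : (free g a).card = g - 2 * (j + 1)
        · exact Or.inl ⟨h1, hc⟩
        · exact Or.inr ⟨h1, by omega⟩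
      · rintro (⟨h1, h2⟩ | ⟨h1, h2⟩)
        · exact ⟨h1, by omega⟩
        · exact ⟨h1, by omega⟩
    · rw [Set.disjoint_left]
      rintro a ⟨_, h1⟩ ⟨_, h2⟩
      omega

theorem ncard_eq_choose (g : ℕ) : {a | IsArcDiagram g a}.ncard = g.choose (g / 2) := by
  rw [← ncard_le_card_free g (g / 2) (by omega)]
  congr 1
  ext a
  simp only [Set.mem_ofPred_eq]
  refine ⟨fun h => ⟨h, ?_⟩, fun h => h.1⟩
  have := h.even_add_card_free
  rw [Nat.even_iff] at this
  omega

end IsArcDiagram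

/-- `r` restricts to the order-reversing involution of the finite set `U`. -/
structure IsReversal (U : Finset ℕ) (r : ℕ → ℕ) : Prop where
  mem : ∀ x ∈ U, r x ∈ U
  invol : ∀ x ∈ U, r (r x) = x
  anti : ∀ x ∈ U, ∀ y ∈ U, x < y → r y < r x

namespace IsReversal

theorem eq {U : Finset ℕ} {r s : ℕ → ℕ} (hr : IsReversal U r) (hs : IsReversal U s) {x : ℕ}
    (hx : x ∈ U) : r x = s x := by
  let c : U → U := fun x => ⟨r (s x), hr.mem _ (hs.mem _ x.2)⟩
  have hc : StrictMono c := fun x y h =>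
    hr.anti _ (hs.mem _ y.2) _ (hs.mem _ x.2) (hs.anti _ x.2 _ y.2 h)
  have h1 : r (s x) = x := congrArg Subtype.val
    (le_antisymm (hc.apply_le (x := ⟨x, hx⟩)) (hc.le_apply (x := ⟨x, hx⟩)))
  conv_lhs => rw [← h1]
  exact hr.invol _ (hs.mem _ hx)

theorem exists_isReversal (U : Finset ℕ) :
    ∃ r, IsReversal U r ∧ ((∃ x ∈ U, r x = x) ↔ Odd U.card) := by
  let e := U.orderIsoOfFin rfl
  let r : ℕ → ℕ := fun x => if h : x ∈ U then e (e.symm ⟨x, h⟩).rev else x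
  have hr : ∀ i, r (e i) = e i.rev := fun i => by simp [r]
  have hs : ∀ x ∈ U, ∃ i, x = e i := fun x hx => ⟨e.symm ⟨x, hx⟩, by simp⟩
  refine ⟨r, ⟨?_, ?_, ?_⟩, ?_, ?_⟩
  · intro x hx
    obtain ⟨i, rfl⟩ := hs x hx
    rw [hr]
    exact (e i.rev).2
  · intro x hx
    obtain ⟨i, rfl⟩ := hs x hx
    rw [hr, hr, Fin.rev_rev]
  · intro x hx y hy hxy
    obtain ⟨i, rfl⟩ := hs x hx
    obtain ⟨j, rfl⟩ := hs y hy
    rw [hr, hr]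
    have : i < j := by simpa using hxy
    simpa using this
  · rintro ⟨x, hx, h⟩
    obtain ⟨i, rfl⟩ := hs x hx
    rw [hr] at h
    have h2 : i.rev = i := e.injective (Subtype.ext h)
    have h3 := congrArg Fin.val h2
    rw [Fin.val_rev] at h3
    rw [Nat.odd_iff]
    omega
  · rintro ⟨m, hm⟩
    refine ⟨e ⟨m, by omega⟩, (e _).2, ?_⟩
    rw [hr]
    congr 3
    ext
    rw [Fin.val_rev]
    simp
    omega

end IsReversal

/-- A noncrossing perfect matching of the `g * k` points `{0, …, g * k - 1}` of a circle, invariant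
under rotation by `g`, encoded by its partner function. -/
structure IsPeriodicMatching (g k : ℕ) (f : ℕ → ℕ) : Prop where
  arc : IsArcDiagram (g * k) f
  ne : ∀ x, x < g * k → f x ≠ x
  per : ∀ x, x < g * k → f ((x + g) % (g * k)) = (f x + g) % (g * k)

namespace IsPeriodicMatching

open IsArcDiagram

variable {g k : ℕ} {f : ℕ → ℕ}

theorem lex_lt {g x y i j : ℕ} (hx : x < g) (hy : y < g) :
    x + g * i < y + g * j ↔ i < j ∨ i = j ∧ x < y := by
  constructor
  · intro h
    rcases lt_trichotomy i j with hij | rfl | hij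
    · exact Or.inl hij
    · exact Or.inr ⟨rfl, by omega⟩
    · have := Nat.mul_le_mul_left g (Nat.succ_le_of_lt hij)
      rw [Nat.mul_succ] at this
      omega
  · rintro (hij | ⟨rfl, h⟩)
    · have := Nat.mul_le_mul_left g (Nat.succ_le_of_lt hij)
      rw [Nat.mul_succ] at this
      omega
    · omega

theorem add_mul_lt {g x i k : ℕ} (hx : x < g) (hi : i < k) : x + g * i < g * k := by
  have := (lex_lt (j := k) hx (by omega : 0 < g)).2 (Or.inl hi)
  omega

theorem add_mul_inj {g x y i j : ℕ} (hx : x < g) (hy : y < g) (h : x + g * i = y + g * j) :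
    x = y ∧ i = j := by
  have h1 := (lex_lt (i := i) (j := j) hx hy).not
  have h2 := (lex_lt (i := j) (j := i) hy hx).not
  omega

theorem exists_coord {p : ℕ} (h : p < g * k) : ∃ x i, x < g ∧ i < k ∧ p = x + g * i := by
  have hg : 0 < g := Nat.pos_of_ne_zero fun h0 => by simp [h0] at h
  exact ⟨p % g, p / g, Nat.mod_lt _ hg, Nat.div_lt_of_lt_mul h, (Nat.mod_add_div p g).symm⟩

theorem add_mul_mod {x : ℕ} (hx : x < g) (i : ℕ) : (x + g * i) % (g * k) = x + g * (i % k) := by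
  rw [Nat.mod_mul, Nat.add_mul_mod_self_left, Nat.mod_eq_of_lt hx,
    Nat.add_mul_div_left _ _ (by omega), Nat.div_eq_of_lt hx, zero_add]

theorem per_mul (h : IsPeriodicMatching g k f) {x : ℕ} (hx : x < g * k) (i : ℕ) :
    f ((x + g * i) % (g * k)) = (f x + g * i) % (g * k) := by
  induction i with
  | zero => simp [Nat.mod_eq_of_lt hx, Nat.mod_eq_of_lt (h.arc.lt hx)]
  | succ i ih =>
    have := h.per ((x + g * i) % (g * k)) (Nat.mod_lt _ (by omega))
    rw [ih, Nat.mod_add_mod, Nat.mod_add_mod] at this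
    rw [Nat.mul_succ, ← add_assoc, ← add_assoc, this]

theorem apply_coord (h : IsPeriodicMatching g k f) {x y i j : ℕ} (hx : x < g) (hy : y < g)
    (hi : i < k) (hf : f x = y + g * j) : f (x + g * i) = y + g * ((j + i) % k) := by
  have hk : x < g * k := by
    have := add_mul_lt (k := k) (i := 0) hx (by omega)
    omega
  have h1 := h.per_mul hk i
  rw [hf, add_assoc, ← mul_add, add_mul_mod hx, add_mul_mod hy, Nat.mod_eq_of_lt hi] at h1
  exact h1

theorem exists_apply (h : IsPeriodicMatching g k f) (hk : 0 < k) {x : ℕ} (hx : x < g) :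
    ∃ y j, y < g ∧ j < k ∧ f x = y + g * j := by
  refine exists_coord (h.arc.lt ?_)
  have := add_mul_lt (k := k) (i := 0) hx hk
  omega

theorem apply_partner (h : IsPeriodicMatching g k f) {x y j : ℕ} (hx : x < g) (hy : y < g)
    (hj : j < k) (hf : f x = y + g * j) : f y = x + g * ((k - j) % k) := by
  obtain ⟨z, l, hz, hl, hf'⟩ := h.exists_apply (by omega) hy
  have h1 := h.apply_coord hy hz hj hf'
  rw [← hf, h.arc.invol] at h1
  obtain ⟨rfl, h2⟩ := add_mul_inj (i := 0) hx hz (by omega)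
  rw [hf']
  congr 2
  rcases Nat.eq_zero_or_pos j with rfl | hj0
  · rw [add_zero, Nat.mod_eq_of_lt hl] at h2
    simp [← h2]
  · rw [Nat.mod_eq_of_lt (by omega : k - j < k)]
    have := Nat.div_add_mod (l + j) k
    rw [← h2] at this
    have h3 : (l + j) / k < 2 := Nat.div_lt_of_lt_mul (by omega)
    interval_cases (l + j) / k <;> omega

theorem le_of_window (h : IsPeriodicMatching g k f) {x y j : ℕ} (hx : x < g) (hy : y < g)
    (hj : 1 ≤ j) (hjk : j + 1 < k) (hf : f x = y + g * j) : j = 1 ∧ y ≤ x := by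
  have h1 := h.apply_coord (i := 1) hx hy (by omega) hf
  rw [Nat.mod_eq_of_lt hjk] at h1
  have h2 := h.arc.nest x (x + g * 1) (by omega)
  rw [h1, hf, lex_lt hx hy, lex_lt hy hy] at h2
  omega

/-- An arc leaving a period joins adjacent periods, and its direction is determined. -/
theorem window (h : IsPeriodicMatching g k f) {x y j : ℕ} (hx : x < g) (hy : y < g)
    (hj : 1 ≤ j) (hjk : j < k) (hf : f x = y + g * j) :
    j = if y ≤ x then 1 else k - 1 := by
  by_cases hjk' : j + 1 < k
  · have h1 := h.le_of_window hx hy hj hjk' hf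
    rw [if_pos h1.2, h1.1]
  · by_cases h2 : k = 2
    · split_ifs <;> omega
    · have h3 := h.apply_partner hx hy hjk hf
      rw [show k - j = 1 by omega, Nat.mod_eq_of_lt (by omega)] at h3
      have h4 := h.le_of_window hy hx le_rfl (by omega) h3
      have h5 : x ≠ y := by
        rintro rfl
        have := add_mul_inj hx hy (hf.symm.trans h3)
        omega
      rw [if_neg (by omega)]
      omega

/-- The part of the matching inside the first period. -/
def core (g : ℕ) (f : ℕ → ℕ) (x : ℕ) : ℕ := if x < g ∧ f x < g then f x else x

theorem core_isArcDiagram (h : IsPeriodicMatching g k f) (hk : 0 < k) :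
    IsArcDiagram g (core g f) := by
  have hgk : g ≤ g * k := Nat.le_mul_of_pos_right g hk
  refine ⟨fun x => ?_, fun x hx => ?_, fun x y hxy hy => ?_⟩
  · by_cases hx : x < g ∧ f x < g
    · simp [core, hx, h.arc.invol]
    · simp [core, hx]
  · rw [core, if_neg (by omega)]
  · unfold core at *
    by_cases hx : x < g ∧ f x < g
    · rw [if_pos hx] at *
      have h1 := h.arc.nest x y hxy hy
      rw [if_pos (by omega)]
      exact h1
    · rw [if_neg hx] at *
      omega

theorem mem_free_core (h : IsPeriodicMatching g k f) (hk : 0 < k) {x : ℕ} :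
    x ∈ free g (core g f) ↔ x < g ∧ g ≤ f x := by
  have hgk : g ≤ g * k := Nat.le_mul_of_pos_right g hk
  rw [mem_free, core]
  by_cases hx : x < g
  · have := h.ne x (by omega)
    split_ifs with h1 <;> omega
  · omega

theorem exists_apply_of_mem_free (h : IsPeriodicMatching g k f) (hk : 0 < k) {x : ℕ}
    (hx : x ∈ free g (core g f)) :
    x < g ∧ ∃ y j, y < g ∧ 1 ≤ j ∧ j < k ∧ f x = y + g * j ∧ f x % g = y ∧
      f y = x + g * (k - j) ∧ y ∈ free g (core g f) ∧ j = if y ≤ x then 1 else k - 1 := by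
  rw [h.mem_free_core hk] at hx
  obtain ⟨y, j, hy, hj, hf⟩ := h.exists_apply hk hx.1
  have hj0 : 1 ≤ j := by
    by_contra! hc
    obtain rfl : j = 0 := by omega
    omega
  have h1 := h.apply_partner hx.1 hy hj hf
  rw [Nat.mod_eq_of_lt (by omega)] at h1
  refine ⟨hx.1, y, j, hy, hj0, hj, hf, ?_, h1, ?_, h.window hx.1 hy hj0 hj hf⟩
  · rw [hf, Nat.add_mul_mod_self_left, Nat.mod_eq_of_lt hy]
  · rw [h.mem_free_core hk, h1]
    exact ⟨hy, le_add_left (Nat.le_mul_of_pos_right g (by omega))⟩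

theorem isReversal_mod (h : IsPeriodicMatching g k f) (hk : 2 ≤ k) :
    IsReversal (free g (core g f)) fun x => f x % g := by
  refine ⟨fun x hx => ?_, fun x hx => ?_, fun x hx x' hx' hxx => ?_⟩
  · obtain ⟨-, y, j, -, -, -, -, rfl, -, h1, -⟩ := h.exists_apply_of_mem_free (by omega) hx
    exact h1
  · obtain ⟨hx, y, j, -, -, -, -, h2, h1, -⟩ := h.exists_apply_of_mem_free (by omega) hx
    simp only [h2, h1]
    rw [Nat.add_mul_mod_self_left, Nat.mod_eq_of_lt hx]
  · obtain ⟨hx, y, j, hy, hj1, hj, hf, h1, hfy, -, hw⟩ :=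
      h.exists_apply_of_mem_free (by omega) hx
    obtain ⟨hx', y', j', hy', hj1', hj', hf', h1', hfy', -, hw'⟩ :=
      h.exists_apply_of_mem_free (by omega) hx'
    simp only [h1, h1']
    have h2 := h.arc.nest x x' hxx
    have h3 := h.arc.nest y y'
    have e1 : x' < y + g * j ↔ 0 < j ∨ 0 = j ∧ x' < y := by
      simpa using lex_lt (i := 0) (j := j) hx' hy
    have e2 : y' < x + g * (k - j) ↔ 0 < k - j ∨ 0 = k - j ∧ y' < x := by
      simpa using lex_lt (i := 0) (j := k - j) hy' hx
    have e3 : y = y' → x = x' := by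
      rintro rfl
      exact (add_mul_inj hx hx' (hfy.symm.trans hfy')).1
    rw [hf, hf', lex_lt hy' hy, e1] at h2
    rw [hfy, hfy', lex_lt hx' hx, e2] at h3
    split_ifs at hw hw' <;> omega

theorem core_injective {f' : ℕ → ℕ} (hk : 2 ≤ k) (h : IsPeriodicMatching g k f)
    (h' : IsPeriodicMatching g k f') (he : core g f = core g f') : f = f' := by
  have key : ∀ x < g, f x = f' x := by
    intro x hx
    by_cases hx' : x ∈ free g (core g f)
    · have h1 := (h.isReversal_mod hk).eq (he ▸ h'.isReversal_mod hk) hx'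
      obtain ⟨-, y, j, -, -, -, hf, hm, -, -, hw⟩ := h.exists_apply_of_mem_free (by omega) hx'
      rw [he] at hx'
      obtain ⟨-, y', j', -, -, -, hf', hm', -, -, hw'⟩ :=
        h'.exists_apply_of_mem_free (by omega) hx'
      have h2 : y = y' := by rw [← hm, ← hm', h1]
      rw [hf, hf', hw, hw', h2]
    · have h1 := hx'
      rw [he, h'.mem_free_core (by omega)] at h1
      rw [h.mem_free_core (by omega)] at hx'
      have := congrFun he x
      rwa [core, core, if_pos (by omega), if_pos (by omega)] at this
  funext p
  by_cases hp : p < g * k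
  · obtain ⟨x, i, hx, hi, rfl⟩ := exists_coord hp
    obtain ⟨y, j, hy, hj, hf⟩ := h.exists_apply (by omega) hx
    rw [h.apply_coord hx hy hi hf, h'.apply_coord hx hy hi ((key x hx).symm.trans hf)]
  · rw [h.arc.fix p (by omega), h'.arc.fix p (by omega)]

theorem even_of_three_le (hk : 3 ≤ k) (h : IsPeriodicMatching g k f) : Even g := by
  obtain ⟨r, hr, hodd⟩ := IsReversal.exists_isReversal (free g (core g f))
  have h1 := (h.core_isArcDiagram (by omega)).even_add_card_free
  by_contra hg
  rw [Nat.even_add, ← not_iff_not, Nat.not_even_iff_odd, Nat.not_even_iff_odd] at h1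
  obtain ⟨x, hx, hrx⟩ := hodd.2 (h1.1 (Nat.not_even_iff_odd.1 hg))
  rw [hr.eq (h.isReversal_mod (by omega)) hx] at hrx
  obtain ⟨hx, y, j, hy, hj1, hj, hf, h1, hfy, -, hw⟩ := h.exists_apply_of_mem_free (by omega) hx
  obtain rfl : y = x := by rw [← h1, hrx]
  have := add_mul_inj hx hy (hf.symm.trans hfy)
  rw [if_pos le_rfl] at hw
  omega

/-- Partner position inside a period, where the unmatched points of `a` are paired by `r`. -/
def unfoldPos (a r : ℕ → ℕ) (x : ℕ) : ℕ := if a x = x then r x else a x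

/-- Period containing the partner of the point at position `x` of period `i`. -/
def unfoldWindow (k : ℕ) (a r : ℕ → ℕ) (i x : ℕ) : ℕ :=
  if a x = x then
    if r x ≤ x then (if i + 1 = k then 0 else i + 1) else (if i = 0 then k - 1 else i - 1)
  else i

/-- The periodic matching with core `a` whose arcs between periods are given by `r`. -/
def unfold (g k : ℕ) (a r : ℕ → ℕ) (p : ℕ) : ℕ :=
  if p < g * k then unfoldPos a r (p % g) + g * unfoldWindow k a r (p / g) (p % g) else p

theorem unfold_apply {a r : ℕ → ℕ} {x i : ℕ} (hx : x < g) (hi : i < k) :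
    unfold g k a r (x + g * i) = unfoldPos a r x + g * unfoldWindow k a r i x := by
  rw [unfold, if_pos (add_mul_lt hx hi), Nat.add_mul_mod_self_left, Nat.mod_eq_of_lt hx,
    Nat.add_mul_div_left _ _ (by omega), Nat.div_eq_of_lt hx, zero_add]

section

variable {a r : ℕ → ℕ} (ha : IsArcDiagram g a) (hr : IsReversal (free g a) r)
include ha hr

theorem unfoldPos_lt {x : ℕ} (hx : x < g) : unfoldPos a r x < g := by
  unfold unfoldPos
  split_ifs with h
  · exact (mem_free.1 (hr.mem x (mem_free.2 ⟨hx, h⟩))).1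
  · exact ha.lt hx

theorem unfoldPos_invol {x : ℕ} (hx : x < g) : unfoldPos a r (unfoldPos a r x) = x := by
  unfold unfoldPos
  by_cases h : a x = x
  · have h1 := mem_free.2 ⟨hx, h⟩
    rw [if_pos h, if_pos (mem_free.1 (hr.mem x h1)).2, hr.invol x h1]
  · have := ha.invol x
    rw [if_neg h, if_neg (by rw [this]; exact Ne.symm h), this]

omit ha hr in
theorem unfoldWindow_lt {x i : ℕ} (hi : i < k) : unfoldWindow k a r i x < k := by
  unfold unfoldWindow
  split_ifs <;> omega

theorem unfoldWindow_invol {x i : ℕ} (hx : x < g) (hi : i < k)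
    (h2 : ∀ x ∈ free g a, r x = x → k = 2) :
    unfoldWindow k a r (unfoldWindow k a r i x) (unfoldPos a r x) = i := by
  by_cases h : a x = x
  · have h1 := mem_free.2 ⟨hx, h⟩
    have h3 := (mem_free.1 (hr.mem x h1)).2
    have h4 := hr.invol x h1
    have h5 := h2 x h1
    simp only [unfoldWindow, unfoldPos, h, h3, h4, if_true]
    grind
  · have := ha.invol x
    simp only [unfoldWindow, unfoldPos, h, this, if_false]
    rw [if_neg (Ne.symm h)]

theorem unfold_nest (hk : 2 ≤ k) {x y i j : ℕ} (hx : x < g) (hy : y < g) (hi : i < k)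
    (hj : j < k) (hxy : i < j ∨ i = j ∧ x < y)
    (h1 : j < unfoldWindow k a r i x ∨ j = unfoldWindow k a r i x ∧ y < unfoldPos a r x)
    (h2 : unfoldWindow k a r i x < unfoldWindow k a r j y ∨
      unfoldWindow k a r i x = unfoldWindow k a r j y ∧ unfoldPos a r x < unfoldPos a r y) :
    False := by
  unfold unfoldPos unfoldWindow at h1 h2
  by_cases hax : a x = x <;> by_cases hay : a y = y
  · have hx' := mem_free.2 ⟨hx, hax⟩
    have hy' := mem_free.2 ⟨hy, hay⟩
    have e1 := hr.anti x hx' y hy'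
    have e2 := hr.anti (r x) (hr.mem x hx') y hy'
    have e3 := hr.anti (r x) (hr.mem x hx') (r y) (hr.mem y hy')
    have e4 := hr.anti y hy' (r x) (hr.mem x hx')
    rw [hr.invol x hx'] at e2 e3 e4
    rw [hr.invol y hy'] at e3
    simp only [hax, hay, if_true] at h1 h2
    split_ifs at h1 h2 <;> omega
  · have hx' := mem_free.2 ⟨hx, hax⟩
    have e1 := ha.nest y (r x)
    have e2 := (mem_free.1 (hr.mem x hx')).2
    simp only [hax, hay, if_true, if_false] at h1 h2
    split_ifs at h1 h2 <;> omega
  · have e1 := ha.nest x y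
    simp only [hax, hay, if_true, if_false] at h1 h2
    split_ifs at h1 h2 <;> omega
  · have e1 := ha.nest x y
    simp only [hax, hay, if_false] at h1 h2
    omega

theorem unfold_isPeriodicMatching (hk : 2 ≤ k) (h2 : ∀ x ∈ free g a, r x = x → k = 2) :
    IsPeriodicMatching g k (unfold g k a r) := by
  have hinv : ∀ p, unfold g k a r (unfold g k a r p) = p := by
    intro p
    by_cases hp : p < g * k
    · obtain ⟨x, i, hx, hi, rfl⟩ := exists_coord hp
      rw [unfold_apply hx hi, unfold_apply (unfoldPos_lt ha hr hx) (unfoldWindow_lt hi),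
        unfoldPos_invol ha hr hx, unfoldWindow_invol ha hr hx hi h2]
    · simp [unfold, hp]
  have hne : ∀ p, p < g * k → unfold g k a r p ≠ p := by
    intro p hp h
    obtain ⟨x, i, hx, hi, rfl⟩ := exists_coord hp
    rw [unfold_apply hx hi] at h
    obtain ⟨h3, h4⟩ := add_mul_inj (unfoldPos_lt ha hr hx) hx h
    unfold unfoldPos at h3
    unfold unfoldWindow at h4
    split_ifs at h3 h4 <;> omega
  refine ⟨⟨hinv, fun p hp => ?_, fun p q hpq hq => ?_⟩, hne, fun p hp => ?_⟩
  · rw [unfold, if_neg (by omega)]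
  · have hp : p < g * k := by
      by_contra hc
      rw [unfold, if_neg hc] at hq
      omega
    obtain ⟨x, i, hx, hi, rfl⟩ := exists_coord hp
    have hq' : q < g * k := by
      rw [unfold_apply hx hi] at hq
      exact hq.trans (add_mul_lt (unfoldPos_lt ha hr hx) (unfoldWindow_lt hi))
    refine ⟨hne q hq', ?_⟩
    by_contra! hc
    obtain ⟨y, j, hy, hj, rfl⟩ := exists_coord hq'
    have hc' := lt_of_le_of_ne hc fun h => hpq.ne (by rw [← hinv (x + g * i), h, hinv])
    rw [unfold_apply hx hi] at hq hc'
    rw [unfold_apply hy hj] at hc'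
    rw [lex_lt hx hy] at hpq
    rw [lex_lt hy (unfoldPos_lt ha hr hx)] at hq
    rw [lex_lt (unfoldPos_lt ha hr hx) (unfoldPos_lt ha hr hy)] at hc'
    exact unfold_nest ha hr hk hx hy hi hj hpq hq hc'
  · obtain ⟨x, i, hx, hi, rfl⟩ := exists_coord hp
    have hmod : ∀ i < k, (i + 1) % k = if i + 1 = k then 0 else i + 1 := by
      intro i hi
      split_ifs with h
      · rw [h, Nat.mod_self]
      · exact Nat.mod_eq_of_lt (by omega)
    rw [unfold_apply hx hi, add_assoc, add_assoc, ← Nat.mul_succ, ← Nat.mul_succ,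
      add_mul_mod hx, add_mul_mod (unfoldPos_lt ha hr hx),
      unfold_apply hx (Nat.mod_lt _ (by omega)), Nat.succ_eq_add_one, Nat.succ_eq_add_one,
      hmod i hi, hmod _ (unfoldWindow_lt hi)]
    congr 2
    unfold unfoldWindow
    grind

omit hr in
theorem core_unfold (hk : 2 ≤ k) : core g (unfold g k a r) = a := by
  funext x
  by_cases hx : x < g
  · have h := unfold_apply (k := k) (a := a) (r := r) (i := 0) hx (by omega)
    rw [mul_zero, add_zero] at h
    rw [core, h]
    by_cases hax : a x = x
    · have hw : 1 ≤ unfoldWindow k a r 0 x := by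
        unfold unfoldWindow
        split_ifs <;> omega
      have := Nat.le_mul_of_pos_right g hw
      rw [if_neg (by omega), hax]
    · have := ha.lt hx
      simp [unfoldPos, unfoldWindow, hax, hx, this]
  · rw [core, if_neg (by omega), ha.fix x (by omega)]

end

theorem bijOn_core (hk : 2 ≤ k) (h : k = 2 ∨ Even g) :
    Set.BijOn (core g) {f | IsPeriodicMatching g k f} {a | IsArcDiagram g a} := by
  refine ⟨fun f hf => hf.core_isArcDiagram (by omega),
    fun f hf f' hf' => core_injective hk hf hf', fun a ha => ?_⟩
  obtain ⟨r, hr, hodd⟩ := IsReversal.exists_isReversal (free g a)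
  refine ⟨unfold g k a r, unfold_isPeriodicMatching ha hr hk fun x hx hrx => ?_,
    core_unfold ha hk⟩
  refine h.resolve_right fun hg => ?_
  have h1 := ha.even_add_card_free
  rw [Nat.even_add] at h1
  exact Nat.not_even_iff_odd.2 (hodd.1 ⟨x, hx, hrx⟩) (h1.1 hg)

theorem ncard_eq_choose (hk : 2 ≤ k) (h : k = 2 ∨ Even g) :
    {f | IsPeriodicMatching g k f}.ncard = g.choose (g / 2) := by
  rw [← IsArcDiagram.ncard_eq_choose, (bijOn_core hk h).ncard_eq]

theorem ncard_eq_zero (hk : 3 ≤ k) (hg : Odd g) : {f | IsPeriodicMatching g k f}.ncard = 0 := by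
  convert Set.ncard_empty (ℕ → ℕ)
  ext f
  simp only [Set.mem_ofPred_eq, Set.mem_empty_iff_false, iff_false]
  exact fun h => Nat.not_even_iff_odd.2 hg (even_of_three_le hk h)

theorem ncard_one_mul (n : ℕ) : {f | IsPeriodicMatching (2 * n) 1 f}.ncard *
    ((n + 1).factorial * n.factorial) = (2 * n).factorial := by
  rw [← ncard_withFree_two_mul]
  congr 2
  ext f
  simp only [Set.mem_ofPred_eq, withFree, Finset.card_eq_zero]
  constructor
  · intro h
    have h1 := h.arc
    have h2 := h.ne
    rw [mul_one] at h1 h2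
    refine ⟨h1, Finset.eq_empty_of_forall_notMem fun x hx => ?_⟩
    rw [mem_free] at hx
    exact h2 x hx.1 hx.2
  · rintro ⟨h1, h2⟩
    refine ⟨by rwa [mul_one], fun x hx he => ?_, fun x hx => ?_⟩
    · have : x ∈ free (2 * n) f := mem_free.2 ⟨by omega, he⟩
      simp [h2] at this
    · rw [mul_one] at *
      have := h1.lt hx
      rw [Nat.add_mod_right, Nat.add_mod_right, Nat.mod_eq_of_lt hx, Nat.mod_eq_of_lt this]

end IsPeriodicMatching

section Rotation

variable {n : ℕ} {M : Finset (Finset (ZMod (2 * n)))}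

theorem image_add_injective (n d : ℕ) : Function.Injective
    fun p : Finset (ZMod (2 * n)) => p.image fun x => x + (d : ZMod (2 * n)) :=
  Finset.image_injective (add_left_injective _)

theorem rotateMatching_add (d e : ℕ) :
    rotateMatching n (d + e) M = rotateMatching n e (rotateMatching n d M) := by
  simp only [rotateMatching, Finset.image_image, Function.comp_def, Nat.cast_add, add_assoc]

theorem rotateMatching_congr {d e : ℕ} (h : d ≡ e [MOD 2 * n]) :
    rotateMatching n d M = rotateMatching n e M := by
  rw [rotateMatching, rotateMatching, (ZMod.natCast_eq_natCast_iff _ _ _).2 h]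

theorem rotateMatching_zero : rotateMatching n 0 M = M := by
  simp [rotateMatching]

theorem rotateMatching_mul {d : ℕ} (h : rotateMatching n d M = M) (j : ℕ) :
    rotateMatching n (d * j) M = M := by
  induction j with
  | zero => exact rotateMatching_zero
  | succ j ih => rw [Nat.mul_succ, rotateMatching_add, ih, h]

theorem rotateMatching_gcd (hn : 0 < n) (d : ℕ) :
    rotateMatching n (d.gcd (2 * n)) M = M ↔ rotateMatching n d M = M := by
  constructor
  · intro h
    obtain ⟨j, hj⟩ := Nat.gcd_dvd_left d (2 * n)
    rw [hj]
    exact rotateMatching_mul h j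
  · intro h
    rcases (Nat.gcd_le_right d (show 0 < 2 * n by omega)).eq_or_lt with hd | hd
    · rw [hd, rotateMatching_congr (e := 0) (by simp [Nat.ModEq]), rotateMatching_zero]
    · obtain ⟨j, -, hj⟩ := Nat.exists_mul_mod_eq_gcd hd
      rw [rotateMatching_congr (e := d * j), rotateMatching_mul h]
      rw [← hj]
      exact Nat.mod_modEq _ _

theorem pair_mem_rotateMatching {d : ℕ} {x y : ZMod (2 * n)} :
    {x + (d : ZMod (2 * n)), y + (d : ZMod (2 * n))} ∈ rotateMatching n d M ↔ {x, y} ∈ M := by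
  rw [rotateMatching, ← (image_add_injective n d).mem_finset_image (s := M) (a := {x, y})]
  simp

theorem IsPerfectMatching.rotate (h : IsPerfectMatching n M) (d : ℕ) :
    IsPerfectMatching n (rotateMatching n d M) := by
  obtain ⟨h1, h2, h3⟩ := h
  refine ⟨?_, ?_, fun x => ?_⟩
  · rw [rotateMatching, Finset.card_image_of_injective _ (image_add_injective n d), h1]
  · simp only [rotateMatching, Finset.mem_image]
    rintro _ ⟨p, hp, rfl⟩
    rw [Finset.card_image_of_injective _ (add_left_injective _), h2 p hp]
  · obtain ⟨p, ⟨hp, hx⟩, hu⟩ := h3 (x - d)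
    refine ⟨p.image fun x => x + (d : ZMod (2 * n)),
      ⟨Finset.mem_image_of_mem _ hp, Finset.mem_image.2 ⟨_, hx, sub_add_cancel _ _⟩⟩, ?_⟩
    rintro q ⟨hq, hxq⟩
    obtain ⟨q, hqM, rfl⟩ := Finset.mem_image.1 hq
    obtain ⟨y, hy, rfl⟩ := Finset.mem_image.1 hxq
    rw [hu q ⟨hqM, by simpa using hy⟩]

theorem IsNoncrossing.rotate_one (h : IsNoncrossing n M) :
    IsNoncrossing n (rotateMatching n 1 M) := by
  rintro ⟨a, b, c, d, hab, hbc, hcd, hd, h1, h2⟩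
  obtain ⟨b, rfl⟩ : ∃ b', b = b' + 1 := ⟨b - 1, by omega⟩
  obtain ⟨c, rfl⟩ : ∃ c', c = c' + 1 := ⟨c - 1, by omega⟩
  obtain ⟨d, rfl⟩ : ∃ d', d = d' + 1 := ⟨d - 1, by omega⟩
  have h2' : ({(b : ZMod (2 * n)), (d : ZMod (2 * n))} : Finset _) ∈ M := by
    rw [← pair_mem_rotateMatching (d := 1)]
    simpa using h2
  cases a with
  | zero =>
    have h1' : ({(c : ZMod (2 * n)), ((2 * n - 1 : ℕ) : ZMod (2 * n))} : Finset _) ∈ M := by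
      rw [← pair_mem_rotateMatching (d := 1), ← Nat.cast_add, ← Nat.cast_add,
        Nat.sub_add_cancel (by omega), ZMod.natCast_self, Finset.pair_comm]
      simpa using h1
    exact h ⟨b, c, d, 2 * n - 1, by omega, by omega, by omega, by omega, h2', h1'⟩
  | succ a =>
    have h1' : ({(a : ZMod (2 * n)), (c : ZMod (2 * n))} : Finset _) ∈ M := by
      rw [← pair_mem_rotateMatching (d := 1)]
      simpa using h1
    exact h ⟨a, b, c, d, by omega, by omega, by omega, by omega, h1', h2'⟩

theorem IsNoncrossing.rotate (h : IsNoncrossing n M) (d : ℕ) :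
    IsNoncrossing n (rotateMatching n d M) := by
  induction d with
  | zero => rwa [rotateMatching_zero]
  | succ d ih =>
    rw [rotateMatching_add]
    exact ih.rotate_one

end Rotation

section PartnerFunction

variable {n : ℕ}

/-- The perfect matching of `ℤ/2nℤ` with partner function `f`. -/
def toMatching (n : ℕ) (f : ℕ → ℕ) : Finset (Finset (ZMod (2 * n))) :=
  (Finset.range (2 * n)).image fun x : ℕ => {(x : ZMod (2 * n)), (f x : ZMod (2 * n))}

theorem natCast_inj_of_lt {m x y : ℕ} (hx : x < m) (hy : y < m) (h : (x : ZMod m) = y) :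
    x = y := by
  rwa [ZMod.natCast_eq_natCast_iff', Nat.mod_eq_of_lt hx, Nat.mod_eq_of_lt hy] at h

theorem exists_natCast_eq (hn : 0 < n) (z : ZMod (2 * n)) : ∃ x < 2 * n, z = (x : ZMod (2 * n)) :=
  have : NeZero (2 * n) := ⟨by omega⟩
  ⟨z.val, z.val_lt, by simp⟩

theorem mem_toMatching {f : ℕ → ℕ} {p : Finset (ZMod (2 * n))} : p ∈ toMatching n f ↔
    ∃ x < 2 * n, {(x : ZMod (2 * n)), (f x : ZMod (2 * n))} = p := by
  simp [toMatching]

theorem pair_mem_toMatching {f : ℕ → ℕ} (hf : IsArcDiagram (2 * n) f) {x y : ℕ} (hx : x < 2 * n)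
    (hy : y < 2 * n) :
    {(x : ZMod (2 * n)), (y : ZMod (2 * n))} ∈ toMatching n f ↔ y = f x := by
  rw [mem_toMatching]
  constructor
  · rintro ⟨z, hz, h⟩
    rw [← Finset.coe_inj, Finset.coe_pair, Finset.coe_pair, Set.pair_eq_pair_iff] at h
    rcases h with ⟨h1, h2⟩ | ⟨h1, h2⟩
    · rw [← natCast_inj_of_lt hz hx h1, natCast_inj_of_lt (hf.lt hz) hy h2]
    · rw [← natCast_inj_of_lt hz hy h1, ← natCast_inj_of_lt (hf.lt hz) hx h2, hf.invol]
  · rintro rfl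
    exact ⟨x, hx, rfl⟩

theorem card_eq_of_existsUnique (hn : 0 < n) {M : Finset (Finset (ZMod (2 * n)))}
    (h2 : ∀ p ∈ M, p.card = 2) (h3 : ∀ x : ZMod (2 * n), ∃! p, p ∈ M ∧ x ∈ p) : M.card = n := by
  have : NeZero (2 * n) := ⟨by omega⟩
  have h4 : ∀ x : ZMod (2 * n), (M.filter fun p => x ∈ p).card = 1 := by
    intro x
    rw [Finset.card_eq_one]
    obtain ⟨p, hp, hu⟩ := h3 x
    refine ⟨p, Finset.ext fun q => ?_⟩
    rw [Finset.mem_filter, Finset.mem_singleton]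
    exact ⟨hu q, fun h => h ▸ hp⟩
  have h5 := Finset.sum_card h4
  rw [Finset.sum_congr rfl h2, Finset.sum_const, ZMod.card, smul_eq_mul] at h5
  omega

theorem toMatching_isPerfectMatching (hn : 0 < n) {f : ℕ → ℕ} (hf : IsArcDiagram (2 * n) f)
    (hne : ∀ x < 2 * n, f x ≠ x) : IsPerfectMatching n (toMatching n f) := by
  have h2 : ∀ p ∈ toMatching n f, p.card = 2 := by
    intro p hp
    obtain ⟨x, hx, rfl⟩ := mem_toMatching.1 hp
    exact Finset.card_pair fun h => hne x hx (natCast_inj_of_lt hx (hf.lt hx) h).symm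
  have h3 : ∀ z : ZMod (2 * n), ∃! p, p ∈ toMatching n f ∧ z ∈ p := by
    intro z
    obtain ⟨x, hx, rfl⟩ := exists_natCast_eq hn z
    refine ⟨{(x : ZMod (2 * n)), (f x : ZMod (2 * n))},
      ⟨mem_toMatching.2 ⟨x, hx, rfl⟩, by simp⟩, ?_⟩
    rintro p ⟨hp, hz⟩
    obtain ⟨y, hy, rfl⟩ := mem_toMatching.1 hp
    rw [Finset.mem_insert, Finset.mem_singleton] at hz
    rcases hz with hz | hz
    · rw [natCast_inj_of_lt hx hy hz]
    · rw [natCast_inj_of_lt hx (hf.lt hy) hz, hf.invol, Finset.pair_comm]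
  exact ⟨card_eq_of_existsUnique hn h2 h3, h2, h3⟩

theorem toMatching_isNoncrossing {f : ℕ → ℕ} (hf : IsArcDiagram (2 * n) f) :
    IsNoncrossing n (toMatching n f) := by
  rintro ⟨a, b, c, d, hab, hbc, hcd, hd, h1, h2⟩
  rw [pair_mem_toMatching hf (by omega) (by omega)] at h1 h2
  have := hf.nest a b hab (by omega)
  omega

theorem natCast_mod_two_mul (x : ℕ) : ((x % (2 * n) : ℕ) : ZMod (2 * n)) = x := by
  rw [ZMod.natCast_eq_natCast_iff', Nat.mod_mod]

theorem rotateMatching_toMatching_iff (hn : 0 < n) {f : ℕ → ℕ} (hf : IsArcDiagram (2 * n) f)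
    (g : ℕ) : rotateMatching n g (toMatching n f) = toMatching n f ↔
      ∀ x < 2 * n, f ((x + g) % (2 * n)) = (f x + g) % (2 * n) := by
  have hlt : ∀ x, x % (2 * n) < 2 * n := fun x => Nat.mod_lt _ (by omega)
  constructor
  · intro h x hx
    have h1 := mem_toMatching.2 ⟨x, hx, Eq.refl {(x : ZMod (2 * n)), (f x : ZMod (2 * n))}⟩
    rw [← pair_mem_rotateMatching (d := g), h, ← Nat.cast_add, ← Nat.cast_add,
      ← natCast_mod_two_mul, ← natCast_mod_two_mul (f x + g),
      pair_mem_toMatching hf (hlt _) (hlt _)] at h1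
    exact h1.symm
  · intro h
    refine Finset.eq_of_subset_of_card_le (fun p hp => ?_) ?_
    · obtain ⟨q, hq, rfl⟩ := Finset.mem_image.1 hp
      obtain ⟨x, hx, rfl⟩ := mem_toMatching.1 hq
      refine mem_toMatching.2 ⟨(x + g) % (2 * n), hlt _, ?_⟩
      rw [h x hx, natCast_mod_two_mul, natCast_mod_two_mul]
      simp
    · rw [rotateMatching, Finset.card_image_of_injective _ (image_add_injective n g)]

theorem exists_toMatching_eq (hn : 0 < n) {M : Finset (Finset (ZMod (2 * n)))}
    (hM : IsPerfectMatching n M) (hM' : IsNoncrossing n M) :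
    ∃ f, IsArcDiagram (2 * n) f ∧ (∀ x < 2 * n, f x ≠ x) ∧ toMatching n f = M := by
  have : NeZero (2 * n) := ⟨by omega⟩
  obtain ⟨-, h2, h3⟩ := hM
  have hex : ∀ x : ZMod (2 * n), ∃ y, y ≠ x ∧ {x, y} ∈ M := by
    intro x
    obtain ⟨p, ⟨hp, hx⟩, -⟩ := h3 x
    obtain ⟨y, z, hyz, rfl⟩ := Finset.card_eq_two.1 (h2 p hp)
    rw [Finset.mem_insert, Finset.mem_singleton] at hx
    rcases hx with rfl | rfl
    · exact ⟨z, hyz.symm, hp⟩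
    · exact ⟨y, hyz, by rwa [Finset.pair_comm]⟩
  choose s hs hsM using hex
  have huniq : ∀ x y, {x, y} ∈ M → y = s x := by
    intro x y hxy
    have h4 := (h3 x).unique ⟨hxy, by simp⟩ ⟨hsM x, by simp⟩
    have h5 : s x ∈ ({x, y} : Finset (ZMod (2 * n))) := by rw [h4]; simp
    rw [Finset.mem_insert, Finset.mem_singleton] at h5
    exact (h5.resolve_left (hs x)).symm
  have hinv : ∀ x, s (s x) = x := fun x =>
    (huniq (s x) x (by rw [Finset.pair_comm]; exact hsM x)).symm
  let f : ℕ → ℕ := fun x => if x < 2 * n then (s x).val else x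
  have hf : ∀ x < 2 * n, f x = (s x).val := fun x hx => if_pos hx
  have hfs : ∀ x < 2 * n, (f x : ZMod (2 * n)) = s x := fun x hx => by
    rw [hf x hx, ZMod.natCast_zmod_val]
  have hlt : ∀ x < 2 * n, f x < 2 * n := fun x hx => by
    rw [hf x hx]
    exact ZMod.val_lt _
  have hfM : ∀ x < 2 * n, {(x : ZMod (2 * n)), (f x : ZMod (2 * n))} ∈ M := fun x hx => by
    rw [hfs x hx]
    exact hsM x
  have hne : ∀ x < 2 * n, f x ≠ x := fun x hx h => hs x (by rw [← hfs x hx, h])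
  have hfix : ∀ x, 2 * n ≤ x → f x = x := fun x hx => if_neg (by omega)
  have hinvf : ∀ x, f (f x) = x := by
    intro x
    by_cases hx : x < 2 * n
    · refine natCast_inj_of_lt (hlt _ (hlt x hx)) hx ?_
      rw [hfs _ (hlt x hx), hfs x hx, hinv]
    · rw [hfix x (by omega), hfix x (by omega)]
  refine ⟨f, ⟨hinvf, hfix, fun x y hxy hy => ?_⟩, hne, ?_⟩
  · have hx : x < 2 * n := by
      by_contra hc
      rw [hfix x (by omega)] at hy
      omega
    have hy' : y < 2 * n := hy.trans (hlt x hx)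
    refine ⟨hne y hy', ?_⟩
    by_contra! hc
    have hc' := lt_of_le_of_ne hc fun h => hxy.ne (by rw [← hinvf x, h, hinvf])
    exact hM' ⟨x, y, f x, f y, hxy, hy, hc', hlt y hy', hfM x hx, hfM y hy'⟩
  · ext p
    rw [mem_toMatching]
    constructor
    · rintro ⟨x, hx, rfl⟩
      exact hfM x hx
    · intro hp
      obtain ⟨z, hz⟩ := Finset.card_pos.1 (by rw [h2 p hp]; omega)
      obtain ⟨x, hx, rfl⟩ := exists_natCast_eq hn z
      exact ⟨x, hx, (h3 x).unique ⟨hfM x hx, by simp⟩ ⟨hp, hz⟩⟩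

theorem bijOn_toMatching (hn : 0 < n) {g k : ℕ} (hgk : g * k = 2 * n) :
    Set.BijOn (toMatching n) {f | IsPeriodicMatching g k f}
      {M | IsPerfectMatching n M ∧ IsNoncrossing n M ∧ rotateMatching n g M = M} := by
  refine ⟨fun f hf => ?_, fun f hf f' hf' h => ?_, fun M ⟨h1, h2, h3⟩ => ?_⟩
  · obtain ⟨h1, h2, h3⟩ := hf
    rw [hgk] at h1 h2 h3
    exact ⟨toMatching_isPerfectMatching hn h1 h2, toMatching_isNoncrossing h1,
      (rotateMatching_toMatching_iff hn h1 g).2 h3⟩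
  · have h1 := hf.arc
    have h2 := hf'.arc
    rw [hgk] at h1 h2
    funext x
    by_cases hx : x < 2 * n
    · rw [← pair_mem_toMatching h2 hx (h1.lt hx), ← h]
      exact mem_toMatching.2 ⟨x, hx, rfl⟩
    · rw [h1.fix x (by omega), h2.fix x (by omega)]
  · obtain ⟨f, hf, hne, rfl⟩ := exists_toMatching_eq hn h1 h2
    refine ⟨f, ⟨hgk ▸ hf, hgk ▸ hne, ?_⟩, rfl⟩
    rw [hgk]
    exact (rotateMatching_toMatching_iff hn hf g).1 h3

theorem card_fixed_eq (hn : 0 < n) (d : ℕ) {k : ℕ} (hk : d.gcd (2 * n) * k = 2 * n) :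
    Nat.card {M : Finset (Finset (ZMod (2 * n))) //
      IsPerfectMatching n M ∧ IsNoncrossing n M ∧ rotateMatching n d M = M} =
      {f | IsPeriodicMatching (d.gcd (2 * n)) k f}.ncard := by
  rw [(bijOn_toMatching hn hk).ncard_eq]
  simp only [rotateMatching_gcd hn]
  rfl

end PartnerFunction

section QCatalan

/-- The `q`-integer `[t]_q`, divided by `[k]_q` when `k ∣ t`. -/
noncomputable def qIntRed (k t : ℕ) : Polynomial ℂ :=
  if k ∣ t then ∑ i ∈ Finset.range (t / k), X ^ (k * i) else qInt t

/-- The `q`-factorial `[m]!_q` with its factors `[k]_q` removed. -/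
noncomputable def qFactRed (k : ℕ) : ℕ → Polynomial ℂ
  | 0 => 1
  | m + 1 => qFactRed k m * qIntRed k (m + 1)

theorem qInt_mul_s5 (k s : ℕ) : qInt (k * s) = qInt k * ∑ i ∈ Finset.range s, X ^ (k * i) := by
  induction s with
  | zero => simp [qInt]
  | succ s ih =>
    rw [Nat.mul_succ, Finset.sum_range_succ, mul_add, ← ih]
    simp only [qInt, Finset.sum_range_add, pow_add, Finset.sum_mul]
    simp only [mul_comm]

theorem qInt_ne_zero_s5 {k : ℕ} (hk : 0 < k) : qInt k ≠ 0 := by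
  intro h
  have := congrArg (Polynomial.eval 1) h
  simp [qInt, Polynomial.eval_finsetSum] at this
  omega

theorem qFact_eq_pow_mul {k : ℕ} (hk : 0 < k) (m : ℕ) :
    qFact m = qInt k ^ (m / k) * qFactRed k m := by
  induction m with
  | zero => simp [qFact, qFactRed]
  | succ m ih =>
    rw [qFact, qFactRed, ih, Nat.succ_div, qIntRed]
    split_ifs with h
    · obtain ⟨s, hs⟩ := h
      rw [hs, Nat.mul_div_cancel_left _ hk, qInt_mul_s5]
      ring
    · ring

theorem eval_qInt (m : ℕ) (ω : ℂ) : (qInt m).eval ω = ∑ i ∈ Finset.range m, ω ^ i := by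
  simp [qInt, Polynomial.eval_finsetSum]

theorem eval_one_qFact (m : ℕ) : (qFact m).eval 1 = m.factorial := by
  induction m with
  | zero => simp [qFact]
  | succ m ih =>
    rw [qFact, Polynomial.eval_mul, ih, eval_qInt, Nat.factorial_succ]
    simp [mul_comm]

variable {k : ℕ} {ω : ℂ}

theorem eval_qFact_ne_zero (hω : IsPrimitiveRoot ω k) {m : ℕ} (hm : m < k) :
    (qFact m).eval ω ≠ 0 := by
  induction m with
  | zero => simp [qFact]
  | succ m ih =>
    rw [qFact, Polynomial.eval_mul]
    refine mul_ne_zero (ih (by omega)) fun h => ?_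
    have := mul_geom_sum ω (m + 1)
    rw [eval_qInt] at h
    rw [h, mul_zero] at this
    exact hω.pow_ne_one_of_pos_of_lt (by omega) hm (sub_eq_zero.1 this.symm)

theorem eval_qIntRed_of_not_dvd (hω : IsPrimitiveRoot ω k) (hk : 2 ≤ k) (e : ℕ) {m : ℕ}
    (hm : m + 1 < k) : (qIntRed k (k * e + m + 1)).eval ω = (qInt (m + 1)).eval ω := by
  have hd : ¬ k ∣ k * e + m + 1 := by
    rw [add_assoc, ← Nat.dvd_add_iff_right (dvd_mul_right k e)]
    exact fun h => absurd (Nat.le_of_dvd (by omega) h) (by omega)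
  rw [qIntRed, if_neg hd, eval_qInt, eval_qInt, add_assoc, Finset.sum_range_add]
  have h0 : ∑ i ∈ Finset.range (k * e), ω ^ i = 0 := by
    rw [← eval_qInt, qInt_mul_s5, Polynomial.eval_mul, eval_qInt,
      hω.geom_sum_eq_zero (by omega), zero_mul]
  rw [h0, zero_add]
  simp [pow_add, pow_mul, hω.pow_eq_one]

theorem eval_qIntRed_mul (hω : IsPrimitiveRoot ω k) (hk : 0 < k) (s : ℕ) :
    (qIntRed k (k * s)).eval ω = s := by
  rw [qIntRed, if_pos (dvd_mul_right k s), Nat.mul_div_cancel_left _ hk]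
  simp [Polynomial.eval_finsetSum, pow_mul, hω.pow_eq_one]

theorem eval_qFactRed (hω : IsPrimitiveRoot ω k) (hk : 2 ≤ k) (e : ℕ) {m : ℕ} (hm : m < k) :
    (qFactRed k (k * e + m)).eval ω =
      e.factorial * (qFact (k - 1)).eval ω ^ e * (qFact m).eval ω := by
  have step : ∀ e, (qFactRed k (k * e)).eval ω = e.factorial * (qFact (k - 1)).eval ω ^ e →
      ∀ m < k, (qFactRed k (k * e + m)).eval ω =
        e.factorial * (qFact (k - 1)).eval ω ^ e * (qFact m).eval ω := by
    intro e he m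
    induction m with
    | zero => simp [he, qFact]
    | succ m ih =>
      intro hm
      rw [← add_assoc, qFactRed, Polynomial.eval_mul, ih (by omega),
        eval_qIntRed_of_not_dvd hω hk e hm, qFact, Polynomial.eval_mul, mul_assoc]
  refine step e ?_ m hm
  induction e with
  | zero => simp [qFactRed]
  | succ e ih =>
    have h := step e ih (k - 1) (by omega)
    have h1 : k * (e + 1) = k * e + (k - 1) + 1 := by rw [Nat.mul_succ]; omega
    rw [h1, qFactRed, Polynomial.eval_mul, h, ← h1, eval_qIntRed_mul hω (by omega),
      Nat.factorial_succ]
    push_cast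
    ring

theorem mul_qFactRed_eq {P : Polynomial ℂ} {n a b c : ℕ} (hk : 0 < k)
    (hP : P * qInt (n + 1) * qFact n * qFact n = qFact (2 * n))
    (ha : (n + 1) / k = a) (hb : n / k = b) (hc : 2 * n / k = a + b + c) :
    P * qFactRed k (n + 1) * qFactRed k n = qInt k ^ c * qFactRed k (2 * n) := by
  have h : P * qFact (n + 1) * qFact n = qFact (2 * n) := by
    rw [← hP, qFact]
    ring
  rw [qFact_eq_pow_mul hk, qFact_eq_pow_mul hk n, qFact_eq_pow_mul hk (2 * n), ha, hb, hc] at h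
  refine mul_left_cancel₀ (pow_ne_zero (a + b) (qInt_ne_zero_s5 hk)) ?_
  linear_combination h

theorem eval_qCatalan_of_even {P : Polynomial ℂ} {n e : ℕ} (hω : IsPrimitiveRoot ω k)
    (hk : 2 ≤ k) (hP : P * qInt (n + 1) * qFact n * qFact n = qFact (2 * n)) (hn : n = k * e) :
    P.eval ω = (2 * e).choose e := by
  have h2 : 2 * n = k * (2 * e) := by rw [hn]; ring
  have h := mul_qFactRed_eq (k := k) (a := e) (b := e) (c := 0) (by omega) hP
    (by rw [hn, Nat.mul_add_div (by omega), Nat.div_eq_of_lt (by omega), add_zero])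
    (by rw [hn, Nat.mul_div_cancel_left _ (by omega)])
    (by rw [h2, Nat.mul_div_cancel_left _ (by omega)]; omega)
  have h := congrArg (Polynomial.eval ω) h
  have e0 : (qFact 0).eval ω = 1 := by simp [qFact]
  have e1 : (qFact 1).eval ω = 1 := by simp [qFact, qInt]
  have r1 := eval_qFactRed hω hk e (m := 1) (by omega)
  have r2 := eval_qFactRed hω hk e (m := 0) (by omega)
  have r3 := eval_qFactRed hω hk (2 * e) (m := 0) (by omega)
  rw [add_zero, e0, ← hn] at r2
  rw [add_zero, e0, ← h2] at r3
  rw [e1, ← hn] at r1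
  have hc := pow_ne_zero (2 * e) (eval_qFact_ne_zero hω (show k - 1 < k by omega))
  have hf : (e.factorial : ℂ) ≠ 0 := Nat.cast_ne_zero.2 e.factorial_ne_zero
  simp only [Polynomial.eval_mul, r1, r2, r3, pow_zero, Polynomial.eval_one] at h
  have hch : ((2 * e).choose e * e.factorial * e.factorial : ℂ) = (2 * e).factorial := by
    have := Nat.choose_mul_factorial_mul_factorial (show e ≤ 2 * e by omega)
    rw [show 2 * e - e = e by omega] at this
    exact_mod_cast this
  refine mul_right_cancel₀ (mul_ne_zero (mul_ne_zero hf hf) hc) ?_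
  linear_combination h - (qFact (k - 1)).eval ω ^ (2 * e) * hch

theorem eval_qCatalan_of_two {P : Polynomial ℂ} {n e : ℕ} (hω : IsPrimitiveRoot ω 2)
    (hP : P * qInt (n + 1) * qFact n * qFact n = qFact (2 * n)) (hn : n = 2 * e + 1) :
    P.eval ω = (2 * e + 1).choose e := by
  have h := mul_qFactRed_eq (k := 2) (a := e + 1) (b := e) (c := 0) (by omega) hP
    (by omega) (by omega) (by omega)
  have h := congrArg (Polynomial.eval ω) h
  have e0 : (qFact 0).eval ω = 1 := by simp [qFact]
  have e1 : (qFact 1).eval ω = 1 := by simp [qFact, qInt]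
  have r1 := eval_qFactRed hω le_rfl (e + 1) (m := 0) (by omega)
  have r2 := eval_qFactRed hω le_rfl e (m := 1) (by omega)
  have r3 := eval_qFactRed hω le_rfl (2 * e + 1) (m := 0) (by omega)
  rw [add_zero, e0, show 2 * (e + 1) = n + 1 by omega] at r1
  rw [e1, ← hn] at r2
  rw [add_zero, e0, ← hn] at r3
  simp only [Polynomial.eval_mul, r1, r2, r3, pow_zero,
    Nat.add_one_sub_one, e1, one_pow, mul_one, one_mul] at h
  rw [hn] at h
  have hf : ((e + 1).factorial * e.factorial : ℂ) ≠ 0 := by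
    exact_mod_cast mul_ne_zero (e + 1).factorial_ne_zero e.factorial_ne_zero
  have hch : ((2 * e + 1).choose e * e.factorial * (e + 1).factorial : ℂ) =
      (2 * e + 1).factorial := by
    have := Nat.choose_mul_factorial_mul_factorial (show e ≤ 2 * e + 1 by omega)
    rw [show 2 * e + 1 - e = e + 1 by omega] at this
    exact_mod_cast this
  refine mul_right_cancel₀ hf ?_
  linear_combination h - hch

theorem eval_qCatalan_of_odd {P : Polynomial ℂ} {n e : ℕ} (hω : IsPrimitiveRoot ω k)
    (hk : 3 ≤ k) (hP : P * qInt (n + 1) * qFact n * qFact n = qFact (2 * n))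
    (hn : 2 * n = k * (2 * e + 1)) : P.eval ω = 0 := by
  obtain ⟨m, hm, hkm⟩ : ∃ m, n = k * e + m ∧ k = 2 * m :=
    ⟨n - k * e, by grind, by grind⟩
  have h := mul_qFactRed_eq (k := k) (a := e) (b := e) (c := 1) (by omega) hP
    (by rw [hm, add_assoc, Nat.mul_add_div (by omega), Nat.div_eq_of_lt (by omega), add_zero])
    (by rw [hm, Nat.mul_add_div (by omega), Nat.div_eq_of_lt (by omega), add_zero])
    (by rw [hn, Nat.mul_div_cancel_left _ (by omega)]; omega)
  have h := congrArg (Polynomial.eval ω) h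
  have r1 := eval_qFactRed hω (by omega) e (m := m + 1) (by omega)
  have r2 := eval_qFactRed hω (by omega) e (m := m) (by omega)
  rw [← hm] at r2
  rw [← add_assoc, ← hm] at r1
  have hne : ∀ j < k, (qFact j).eval ω ≠ 0 := fun j hj => eval_qFact_ne_zero hω hj
  have hf : (e.factorial : ℂ) ≠ 0 := Nat.cast_ne_zero.2 e.factorial_ne_zero
  rw [Polynomial.eval_mul, Polynomial.eval_mul, Polynomial.eval_mul, pow_one, eval_qInt,
    hω.geom_sum_eq_zero (by omega), zero_mul, r1, r2] at h
  simpa [hf, hne (k - 1) (by omega), hne m (by omega), hne (m + 1) (by omega)] using h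

theorem eval_one_qCatalan {P : Polynomial ℂ} {n : ℕ}
    (hP : P * qInt (n + 1) * qFact n * qFact n = qFact (2 * n)) :
    P.eval 1 * ((n + 1).factorial * n.factorial) = (2 * n).factorial := by
  have h := congrArg (Polynomial.eval 1) hP
  simp only [Polynomial.eval_mul, eval_one_qFact, eval_qInt] at h
  rw [← h, Nat.factorial_succ]
  simp
  ring

end QCatalan

/-- **Cyclic sieving for noncrossing perfect matchings (handshake patterns).**
(i) The rotation of a noncrossing perfect matching of `ℤ/2nℤ` is again a noncrossing
perfect matching; and (ii) for `ζ` a primitive `2n`-th root of unity and every polynomial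
`P` with `P · [n+1]_q · [n]!_q · [n]!_q = [2n]!_q` (i.e. the `q`-Catalan number `C_n(q)`),
the number of noncrossing perfect matchings fixed by rotation by `d` equals `P(ζ^d)`. -/
theorem csp_noncrossing_matchings (n : ℕ) (hn : 0 < n)
    (ζ : ℂ) (hζ : IsPrimitiveRoot ζ (2 * n)) :
    (∀ (d : ℕ) (M : Finset (Finset (ZMod (2 * n)))),
      IsPerfectMatching n M → IsNoncrossing n M →
        IsPerfectMatching n (rotateMatching n d M) ∧
        IsNoncrossing n (rotateMatching n d M)) ∧
    ∀ (d : ℕ) (P : Polynomial ℂ),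
      P * qInt (n + 1) * qFact n * qFact n = qFact (2 * n) →
      (Nat.card {M : Finset (Finset (ZMod (2 * n))) //
          IsPerfectMatching n M ∧ IsNoncrossing n M ∧ rotateMatching n d M = M} : ℂ) =
        P.eval (ζ ^ d) := by
  refine ⟨fun d M h1 h2 => ⟨h1.rotate d, h2.rotate d⟩, fun d P hP => ?_⟩
  obtain ⟨k, hk⟩ := Nat.gcd_dvd_right d (2 * n)
  have hω : IsPrimitiveRoot (ζ ^ d) k := by
    have h := IsPrimitiveRoot.orderOf (ζ ^ d)
    have hg : 0 < d.gcd (2 * n) := Nat.gcd_pos_of_pos_right d (by omega)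
    rwa [(hζ.isOfFinOrder (by omega)).orderOf_pow, ← hζ.eq_orderOf, Nat.gcd_comm,
      Nat.div_eq_of_eq_mul_right hg hk] at h
  rw [card_fixed_eq hn d hk.symm]
  generalize d.gcd (2 * n) = g at hk
  generalize ζ ^ d = ω at hω
  obtain rfl | rfl | rfl | hk3 : k = 0 ∨ k = 1 ∨ k = 2 ∨ 3 ≤ k := by omega
  · omega
  · obtain rfl : ω = 1 := by simpa using hω.pow_eq_one
    obtain rfl : g = 2 * n := by omega
    have hf : ((n + 1).factorial * n.factorial : ℂ) ≠ 0 := by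
      exact_mod_cast mul_ne_zero (n + 1).factorial_ne_zero n.factorial_ne_zero
    refine mul_right_cancel₀ hf ?_
    rw [eval_one_qCatalan hP]
    exact_mod_cast IsPeriodicMatching.ncard_one_mul n
  · rw [IsPeriodicMatching.ncard_eq_choose le_rfl (Or.inl rfl)]
    rcases Nat.even_or_odd' g with ⟨e, rfl | rfl⟩
    · rw [eval_qCatalan_of_even (e := e) hω le_rfl hP (by omega),
        Nat.mul_div_cancel_left _ two_pos]
    · rw [eval_qCatalan_of_two (e := e) hω hP (by omega), show (2 * e + 1) / 2 = e by omega]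
  · rcases Nat.even_or_odd' g with ⟨e, rfl | rfl⟩
    · rw [IsPeriodicMatching.ncard_eq_choose (by omega) (Or.inr (even_two_mul e)),
        eval_qCatalan_of_even (e := e) hω (by omega) hP (by linarith),
        Nat.mul_div_cancel_left _ two_pos]
    · rw [IsPeriodicMatching.ncard_eq_zero hk3 (odd_two_mul_add_one e),
        eval_qCatalan_of_odd (e := e) hω hk3 hP (by linarith), Nat.cast_zero]
end
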